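/- Under the Setup, suppose both n−2 and n−1 lie in I_{n−2}^V, and let c be the largest element of I_1^V in the <_1 order. Then: (1) c = n−4 if n−4 ∈ I_1^V \ I_n^V, and c = n−5 otherwise; moreover if c = n−4 then I_1^V \ I_n^V = {n−4}; (2) I_{n−3}^W contributes the same plusses as I_{n−3}^V except that the plus in column n−3 (which necessarily exists) is shifted one square left into column n−2; (3) I_{n−2}^V contributes a c → (n−2) plus, no other term in the Grassmann necklace of V gives a plus in column n−2, and all other plusses of I_{n−2}^V were already contributed by I_{n−3}^V; (4) I_{n−2}^W contributes an (n−3) → (n−2) plus, a c → (n−1) plus, and one further plus, which is the plus contributed by I_n^V if c = n−5 and is the (n−5) → n plus if c = n−4; (5) if c = n−4 then I_{n−1}^V contributes an (n−4) → (n−1) plus, and in any case all other plusses contributed by I_{n−1}^V were already contributed by I_{n−3}^V; (6) the Grassmann necklace of V contributes a c → (n−1) plus if and only if c = n−4, and no term of the Grassmann necklace of V contributes an (n−5) → n plus. -/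

import Mathlib

open scoped Classical

namespace WLD

/-- A propagator of a Wilson loop diagram on the cyclically ordered vertex set
`ZMod n` (vertex `n` is identified with `0`): an unordered pair of edges, the
edge joining vertex `i` to vertex `i+1` being labelled `i`. -/
abbrev Prp (n : ℕ) := Sym2 (ZMod n)

variable (n : ℕ)

/-- The position of `x` in the linear order `i <_i i+1 <_i ⋯ <_i i-1`. -/
def ord (i x : ZMod n) : ℕ := (x - i).val

/-- The other end of a propagator `p` having an end on the edge `e`. -/
noncomputable def otherEnd (p : Prp n) (e : ZMod n) : ZMod n :=
  if h : e ∈ p then Sym2.Mem.other h else e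

/-- The vertex support `V(p) = {i, i+1, j, j+1}` of the propagator `p = (i,j)`. -/
def supp (p : Prp n) : Finset (ZMod n) :=
  Sym2.lift ⟨fun i j => {i, i + 1, j, j + 1}, fun i j => by
    ext x
    simp only [Finset.mem_insert, Finset.mem_singleton]
    tauto⟩ p

/-- The vertex support `V(Q)` of a set of propagators. -/
def suppSet (Q : Finset (Prp n)) : Finset (ZMod n) := Q.biUnion (supp n)

/-- `Prop(U)`: the propagators of `P` supported on (a vertex of) `U`. -/
noncomputable def propsOn (P : Finset (Prp n)) (U : Finset (ZMod n)) : Finset (Prp n) :=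
  P.filter fun p => (supp n p ∩ U).Nonempty

/-- Two propagators `p = (i,j)` and `q = (k,l)` cross if `i < k < j < l` cyclically. -/
def Crossing (p q : Prp n) : Prop :=
  ∃ i j k l : ZMod n, p = s(i, j) ∧ q = s(k, l) ∧
    0 < ord n i k ∧ ord n i k < ord n i j ∧ ord n i j < ord n i l

/-- Weak admissibility of a Wilson loop diagram. -/
structure IsWeaklyAdmissible (P : Finset (Prp n)) : Prop where
  dense : ∀ Q ⊆ P, Q.Nonempty → Q.card + 3 ≤ (suppSet n Q).card
  noncross : ∀ p ∈ P, ∀ q ∈ P, ¬ Crossing n p q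

/-- Admissibility of a Wilson loop diagram. -/
structure IsAdmissible (P : Finset (Prp n)) : Prop where
  card_add_four_le : P.card + 4 ≤ n
  dense : ∀ Q ⊆ P, Q.Nonempty → Q.card + 3 ≤ (suppSet n Q).card
  noncross : ∀ p ∈ P, ∀ q ∈ P, ¬ Crossing n p q

/-- The length of a propagator `p = (i,j)`:
`min(|[i+1, j]|, |[j+1, i]|)`, the number of vertices on its smaller side. -/
def plength (p : Prp n) : ℕ :=
  Sym2.lift ⟨fun i j => min ((j - i - 1).val + 1) ((i - j - 1).val + 1),
    fun _ _ => min_comm _ _⟩ p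

/-- `InsideDir n i p q` : the propagator `q = (k,l)` lies (weakly) inside the
propagator `p = (i,j)` directed from its end `i`, i.e. `i ≤_i k <_i l ≤_i j`. -/
def InsideDir (i : ZMod n) (p q : Prp n) : Prop :=
  ∃ j k l : ZMod n, p = s(i, j) ∧ q = s(k, l) ∧
    ord n i k < ord n i l ∧ ord n i l ≤ ord n i j

/-- Sorting key measuring how far clockwise of the vertex `a` the relevant end of
a propagator supported on `a` is attached: ends on the edge `a-1` are clockwise of
ends on the edge `a`, and on a fixed edge an end is the more clockwise the larger
the propagator is (nestedness of noncrossing propagators sharing an edge). -/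
noncomputable def cwKey (a : ZMod n) (p : Prp n) : ℕ :=
  if a - 1 ∈ p then n + ord n (a - 1) (otherEnd n p (a - 1))
  else ord n a (otherEnd n p a)

/-- The clockwise-most propagator of `S` supported on the vertex `a`, if any. -/
noncomputable def pickCW (S : Finset (Prp n)) (a : ZMod n) : Option (Prp n) :=
  if h : (S.filter fun p => a ∈ supp n p).Nonempty then
    some (Classical.choose
      ((S.filter fun p => a ∈ supp n p).exists_max_image (cwKey n a) h))
  else none

/-- The Grassmann necklace algorithm started at the vertex `i`: after `t` steps,
`(gnRun n P i t).1` is the set of propagators not yet deleted, and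
`(gnRun n P i t).2` records the vertex assigned to each deleted propagator.
Step `t+1` processes the vertex `i + t`: if some not-yet-deleted propagator is
supported on it, the clockwise-most such propagator is deleted and assigned
that vertex. -/
noncomputable def gnRun (P : Finset (Prp n)) (i : ZMod n) :
    ℕ → Finset (Prp n) × (Prp n → Option (ZMod n))
  | 0 => (P, fun _ => none)
  | t + 1 =>
    match pickCW n (gnRun P i t).1 (i + (t : ZMod n)) with
    | none => gnRun P i t
    | some p => ((gnRun P i t).1.erase p,
        Function.update (gnRun P i t).2 p (some (i + (t : ZMod n))))

/-- `I_i^W(p)`: the vertex contributed by the propagator `p` to the Grassmann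
necklace term `I_i^W` (as an `Option`; the algorithm makes one full circuit of
the vertex set, i.e. runs for `n` steps). -/
noncomputable def gnAssign (P : Finset (Prp n)) (i : ZMod n) (p : Prp n) :
    Option (ZMod n) :=
  (gnRun n P i n).2 p

/-- The Grassmann necklace term `I_i^W` produced by the algorithm. -/
noncomputable def gnSet [NeZero n] (P : Finset (Prp n)) (i : ZMod n) :
    Finset (ZMod n) :=
  Finset.univ.filter fun v => ∃ p, gnAssign n P i p = some v

/-- The cyclic interval `{a, a+1, …, a + (len-1)}` in `ZMod n`. -/
def cInterval [NeZero n] (a : ZMod n) (len : ℕ) : Finset (ZMod n) :=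
  Finset.univ.filter fun x => ord n a x < len

/-- A Grassmann necklace of type `(k, n)`: a cyclic sequence of `k`-element
subsets of the vertex set such that `I_{i+1} = (I_i \ {i}) ∪ {j}` for some `j`
whenever `i ∈ I_i`, and `I_{i+1} = I_i` otherwise. -/
def IsGrassmannNecklace [NeZero n] (k : ℕ) (I : ZMod n → Finset (ZMod n)) : Prop :=
  (∀ i, (I i).card = k) ∧
  ∀ i : ZMod n,
    (i ∈ I i → ∃ j : ZMod n, I (i + 1) = insert j ((I i).erase i)) ∧
    (i ∉ I i → I (i + 1) = I i)

/-- Independence in the matroid `M(W)`: no subset `U` of `J` supports fewer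
propagators than the vertices it contains. -/
def Indep (P : Finset (Prp n)) (J : Finset (ZMod n)) : Prop :=
  ∀ U ⊆ J, U.card ≤ (propsOn n P U).card

/-- `A` is lexicographically smaller than `B` with respect to the order `<_i`:
the `<_i`-least element of the symmetric difference lies in `A`. -/
def LexLt (i : ZMod n) (A B : Finset (ZMod n)) : Prop :=
  ∃ v, v ∈ A ∧ v ∉ B ∧ ∀ w, ord n i w < ord n i v → (w ∈ A ↔ w ∈ B)

/-- A `+` is placed in the box `(a, b)` of the Le diagram with row labels `I₁`
by the necklace term `Ii`: writing `I₁ \ Ii = {a₁ > ⋯ > a_r}` and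
`Ii \ I₁ = {b₁ < ⋯ < b_r}` in the `<₁` order, the plusses are in the boxes
`(a_t, b_t)`. -/
def LePlusAt (I₁ Ii : Finset (ZMod n)) (a b : ZMod n) : Prop :=
  a ∈ I₁ \ Ii ∧ b ∈ Ii \ I₁ ∧
    ((I₁ \ Ii).filter fun x => ord n 1 a < ord n 1 x).card =
      ((Ii \ I₁).filter fun y => ord n 1 y < ord n 1 b).card

/-- The box `(a, b)` of the Le diagram of the diagram `P` contains a `+`. -/
def LePlus [NeZero n] (P : Finset (Prp n)) (a b : ZMod n) : Prop :=
  ∃ i : ZMod n, LePlusAt n (gnSet n P 1) (gnSet n P i) a b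

/-- The number of `+` entries in the Le diagram of the diagram `P`. -/
noncomputable def plusCount [NeZero n] (P : Finset (Prp n)) : ℕ :=
  (Finset.univ.filter fun ab : ZMod n × ZMod n => LePlus n P ab.1 ab.2).card

/-- The length of the row labelled `a` of the Young diagram with row labels `I₁`
(the boxes of row `a` are indexed by the column labels `b ∉ I₁` with `a <₁ b`). -/
noncomputable def rowLen [NeZero n] (I₁ : Finset (ZMod n)) (a : ZMod n) : ℕ :=
  (Finset.univ.filter fun b => b ∉ I₁ ∧ ord n 1 a < ord n 1 b).card

/-- The entry of the matrix `C(W)` in row `p` and column `q`: the indeterminate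
`x_{p,q}` if `q ∈ V(p)`, and `0` otherwise. -/
noncomputable def CW (p : Prp n) (q : ZMod n) : MvPolynomial (Prp n × ZMod n) ℝ :=
  if q ∈ supp n p then MvPolynomial.X (p, q) else 0

/-- The column paired with the row `p` in the minors determined by `I_i^W`. -/
noncomputable def colOf (P : Finset (Prp n)) (i : ZMod n) (p : Prp n) : ZMod n :=
  (gnAssign n P i p).getD i

/-- `Δ_{I_i}`: the determinant of the `k × k` minor of `C(W)` on the columns
indexed by `I_i^W`, rows and columns paired via the necklace assignment. -/
noncomputable def Delta (P : Finset (Prp n)) (i : ZMod n) :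
    MvPolynomial (Prp n × ZMod n) ℝ :=
  Matrix.det (Matrix.of fun p q : ↥P => CW n (p : Prp n) (colOf n P i (q : Prp n)))

/-- `S_i`: the propagators whose contribution changes from `I_{i-1}` to `I_i`. -/
noncomputable def Schanged (P : Finset (Prp n)) (i : ZMod n) : Finset (Prp n) :=
  P.filter fun p => gnAssign n P (i - 1) p ≠ gnAssign n P i p

/-- `r_i`: the determinant of the minor of `C(W)` with rows indexed by `S_i` and
columns indexed by `I_i(S_i)` (equal to `1` when `S_i = ∅`). -/
noncomputable def rfac (P : Finset (Prp n)) (i : ZMod n) :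
    MvPolynomial (Prp n × ZMod n) ℝ :=
  Matrix.det
    (Matrix.of fun p q : ↥(Schanged n P i) => CW n (p : Prp n) (colOf n P i (q : Prp n)))

/-- `R = ∏ᵢ rᵢ`, the polynomial produced by the algorithm. -/
noncomputable def Rpoly [NeZero n] (P : Finset (Prp n)) :
    MvPolynomial (Prp n × ZMod n) ℝ :=
  ∏ i : ZMod n, rfac n P i

/-- Position of the end of the propagator `p` along the edge `e`: larger values
attach closer to the vertex `e`, i.e. earlier in the counterclockwise ordering
of the ends of propagators along the edge `e`. -/
noncomputable def edgeKey (e : ZMod n) (p : Prp n) : ℕ := ord n e (otherEnd n p e)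

/-- The propagators of `P` with an end on the edge `e`. -/
noncomputable def onEdge (P : Finset (Prp n)) (e : ZMod n) : Finset (Prp n) :=
  P.filter fun p => e ∈ p

/-- `p` is the first propagator (`p₁`) on the edge `e` in the counterclockwise
ordering of the propagators with an end on the edge `e`. -/
def IsCcwFirst (P : Finset (Prp n)) (e : ZMod n) (p : Prp n) : Prop :=
  p ∈ onEdge n P e ∧ ∀ q ∈ onEdge n P e, edgeKey n e q ≤ edgeKey n e p

/-- `p` is the last propagator (`p_r`) on the edge `e` in the counterclockwise
ordering of the propagators with an end on the edge `e`. -/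
def IsCcwLast (P : Finset (Prp n)) (e : ZMod n) (p : Prp n) : Prop :=
  p ∈ onEdge n P e ∧ ∀ q ∈ onEdge n P e, edgeKey n e p ≤ edgeKey n e q

/-- `p` and `q` are consecutive, in this order (`p = p_j`, `q = p_{j+1}`), in the
counterclockwise ordering of the propagators with an end on the edge `e`. -/
def ConsecOnEdge (P : Finset (Prp n)) (e : ZMod n) (p q : Prp n) : Prop :=
  p ∈ onEdge n P e ∧ q ∈ onEdge n P e ∧ edgeKey n e q < edgeKey n e p ∧
    ∀ r ∈ onEdge n P e, ¬ (edgeKey n e q < edgeKey n e r ∧ edgeKey n e r < edgeKey n e p)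

/-- The factor `R_e` of the denominator `R(W)` associated to the edge `e`:
`R_e = x_{p₁,e+1} • ∏_{j=1}^{r-1} (x_{p_j,e} x_{p_{j+1},e+1} - x_{p_{j+1},e} x_{p_j,e+1}) • x_{p_r,e}`
for the counterclockwise ordering `p₁, …, p_r` of the propagators on the edge `e`
(`R_e = 1` if there are none). -/
noncomputable def Redge (P : Finset (Prp n)) (e : ZMod n) :
    MvPolynomial (Prp n × ZMod n) ℝ :=
  (∏ p ∈ (onEdge n P e).filter (IsCcwFirst n P e), MvPolynomial.X (p, e + 1)) *
    (∏ pq ∈ (P ×ˢ P).filter (fun pq => ConsecOnEdge n P e pq.1 pq.2),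
      (MvPolynomial.X (pq.1, e) * MvPolynomial.X (pq.2, e + 1) -
        MvPolynomial.X (pq.2, e) * MvPolynomial.X (pq.1, e + 1))) *
    (∏ p ∈ (onEdge n P e).filter (IsCcwLast n P e), MvPolynomial.X (p, e))

/-- The denominator `R(W) = ∏ₑ R_e` of the integrand `Ω(W)`. -/
noncomputable def RW [NeZero n] (P : Finset (Prp n)) :
    MvPolynomial (Prp n × ZMod n) ℝ :=
  ∏ e : ZMod n, Redge n P e

/-- The relabelling map associated to the removal of the vertex `i` from the
vertex set `ZMod n`: the vertex of `ZMod (n-1)` in position `t` (in the `<₁`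
order) is sent to the vertex of `ZMod n` in position `t` if `t` precedes the
position of `i`, and to the vertex in position `t+1` otherwise. -/
noncomputable def liftVert (i : ZMod n) (x : ZMod (n - 1)) : ZMod n :=
  1 + ((if ord (n - 1) 1 x < ord n 1 i then ord (n - 1) 1 x
        else ord (n - 1) 1 x + 1 : ℕ) : ZMod n)

end WLD
namespace WLD

/-- The diagram `V` of the Setup: the diagram `W` with the length-2 propagator
`p = (n-3, n-1)` removed. -/
noncomputable def eraseP (n : ℕ) (P : Finset (Prp n)) : Finset (Prp n) :=
  P.erase (s(-3, -1) : Prp n)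

section Basics

variable {n : ℕ}

theorem mem_supp {p : Prp n} {x : ZMod n} : x ∈ supp n p ↔ ∃ e ∈ p, x = e ∨ x = e + 1 := by
  induction p using Sym2.ind with
  | _ i j =>
    simp only [supp, Sym2.lift_mk, Finset.mem_insert, Finset.mem_singleton, Sym2.mem_iff]
    constructor
    · rintro (h | h | h | h)
      exacts [⟨i, Or.inl rfl, Or.inl h⟩, ⟨i, Or.inl rfl, Or.inr h⟩, ⟨j, Or.inr rfl, Or.inl h⟩,
        ⟨j, Or.inr rfl, Or.inr h⟩]
    · rintro ⟨e, rfl | rfl, h | h⟩ <;> simp [h]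

theorem mem_suppSet {Q : Finset (Prp n)} {x : ZMod n} :
    x ∈ suppSet n Q ↔ ∃ p ∈ Q, x ∈ supp n p := by
  simp [suppSet]

theorem suppSet_mono {Q Q' : Finset (Prp n)} (h : Q ⊆ Q') : suppSet n Q ⊆ suppSet n Q' :=
  Finset.biUnion_subset_biUnion_of_subset_left _ h

theorem otherEnd_spec {p : Prp n} {e : ZMod n} (h : e ∈ p) : p = s(e, otherEnd n p e) := by
  rw [otherEnd, dif_pos h]
  exact (Sym2.other_spec h).symm

theorem otherEnd_mk (e j : ZMod n) : otherEnd n s(e, j) e = j := by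
  have h := otherEnd_spec (Sym2.mem_mk_left e j)
  exact (Sym2.congr_right.1 h).symm

@[simp] theorem ord_self (i : ZMod n) : ord n i i = 0 := by simp [ord]

theorem ord_add_natCast (i : ZMod n) {t : ℕ} (ht : t < n) : ord n i (i + (t : ZMod n)) = t := by
  rw [ord, add_sub_cancel_left, ZMod.val_natCast, Nat.mod_eq_of_lt ht]

section Ord

variable [NeZero n]

theorem ord_eq (i x : ZMod n) :
    ord n i x = if i.val ≤ x.val then x.val - i.val else n + x.val - i.val := by
  unfold ord
  split_ifs with h
  · exact ZMod.val_sub h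
  · have hx := x.val_lt
    have hi := i.val_lt
    have : x - i = ((n + x.val - i.val : ℕ) : ZMod n) := by
      rw [Nat.cast_sub (by omega)]
      simp
    rw [this, ZMod.val_natCast, Nat.mod_eq_of_lt (by omega)]

theorem val_add_one' (x : ZMod n) : (x + 1).val = if x.val + 1 = n then 0 else x.val + 1 := by
  have hx := x.val_lt
  have : x + 1 = ((x.val + 1 : ℕ) : ZMod n) := by simp
  rw [this, ZMod.val_natCast]
  split_ifs with h
  · simp [h]
  · exact Nat.mod_eq_of_lt (by omega)

theorem ord_lt (i x : ZMod n) : ord n i x < n := ZMod.val_lt _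

theorem ord_inj {i x y : ZMod n} : ord n i x = ord n i y ↔ x = y := by
  refine ⟨fun h => ?_, fun h => h ▸ rfl⟩
  exact sub_left_injective (ZMod.val_injective n h)

theorem ord_eq_zero {i x : ZMod n} : ord n i x = 0 ↔ x = i := by
  rw [← ord_self i, ord_inj]

theorem add_ord (i x : ZMod n) : i + (ord n i x : ZMod n) = x := by simp [ord]

theorem ord_succ (i x : ZMod n) :
    ord n i (x + 1) = if ord n i x + 1 = n then 0 else ord n i x + 1 := by
  have : x + 1 - i = (x - i) + 1 := by ring
  rw [ord, this, val_add_one']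
  rfl

theorem ord_succ_left (i x : ZMod n) :
    ord n (i + 1) x = if ord n i x = 0 then n - 1 else ord n i x - 1 := by
  have h := ord_succ (i + 1) (x - 1)
  have h2 : ord n (i + 1) (x - 1 + 1) = ord n (i + 1) x := by rw [sub_add_cancel]
  have h3 : ord n i x = ord n (i + 1) x + 1 ∨ (ord n i x = 0 ∧ ord n (i + 1) x + 1 = n) := by
    have e : x - i = (x - (i + 1)) + 1 := by ring
    have := val_add_one' (x - (i + 1))
    rw [← e] at this
    change ord n i x = if ord n (i + 1) x + 1 = n then 0 else ord n (i + 1) x + 1 at this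
    split_ifs at this <;> omega
  have := NeZero.pos n
  split_ifs <;> omega

theorem cwKey_inj {a : ZMod n} {p q : Prp n} (hp : a ∈ supp n p) (hq : a ∈ supp n q)
    (h : cwKey n a p = cwKey n a q) : p = q := by
  have key : ∀ r : Prp n, a ∈ supp n r → a - 1 ∉ r → a ∈ r := by
    intro r hr hr'
    obtain ⟨e, he, rfl | rfl⟩ := mem_supp.1 hr
    · exact he
    · simp [he] at hr'
  have l1 := ord_lt a (otherEnd n p a)
  have l2 := ord_lt a (otherEnd n q a)
  unfold cwKey at h
  split_ifs at h with h1 h2 h2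
  · rw [otherEnd_spec h1, otherEnd_spec h2, ord_inj.1 (Nat.add_left_cancel h)]
  · omega
  · omega
  · rw [otherEnd_spec (key p hp h1), otherEnd_spec (key q hq h2), ord_inj.1 h]

end Ord

end Basics

section Greedy

variable {n : ℕ}

/-- One step of the Grassmann necklace algorithm: the propagators left after visiting `a`. -/
noncomputable def greedyStep (S : Finset (Prp n)) (a : ZMod n) : Finset (Prp n) :=
  match pickCW n S a with
  | none => S
  | some p => S.erase p

/-- The propagators of `S` left after visiting `a, a + 1, …, a + (t - 1)`. -/
noncomputable def greedyRun (S : Finset (Prp n)) (a : ZMod n) : ℕ → Finset (Prp n)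
  | 0 => S
  | t + 1 => greedyStep (greedyRun S a t) (a + (t : ZMod n))

theorem pickCW_eq_none {S : Finset (Prp n)} {a : ZMod n} (h : pickCW n S a = none) :
    ∀ p ∈ S, a ∉ supp n p := by
  unfold pickCW at h
  split_ifs at h with h'
  intro p hp ha
  exact h' ⟨p, Finset.mem_filter.2 ⟨hp, ha⟩⟩

theorem pickCW_eq_some {S : Finset (Prp n)} {a : ZMod n} {p : Prp n}
    (h : pickCW n S a = some p) :
    p ∈ S ∧ a ∈ supp n p ∧ ∀ q ∈ S, a ∈ supp n q → cwKey n a q ≤ cwKey n a p := by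
  unfold pickCW at h
  split_ifs at h with h'
  have hs := Classical.choose_spec
    ((S.filter fun p => a ∈ supp n p).exists_max_image (cwKey n a) h')
  rw [Option.some.inj h] at hs
  have hm := Finset.mem_filter.1 hs.1
  exact ⟨hm.1, hm.2, fun q hq ha => hs.2 q (Finset.mem_filter.2 ⟨hq, ha⟩)⟩

theorem greedyStep_cases (S : Finset (Prp n)) (a : ZMod n) :
    (greedyStep S a = S ∧ ∀ p ∈ S, a ∉ supp n p) ∨
      ∃ p ∈ S, a ∈ supp n p ∧ (∀ q ∈ S, a ∈ supp n q → cwKey n a q ≤ cwKey n a p) ∧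
        greedyStep S a = S.erase p := by
  unfold greedyStep
  rcases h : pickCW n S a with _ | p
  · exact Or.inl ⟨rfl, pickCW_eq_none h⟩
  · obtain ⟨h1, h2, h3⟩ := pickCW_eq_some h
    exact Or.inr ⟨p, h1, h2, h3, rfl⟩

theorem greedyStep_subset (S : Finset (Prp n)) (a : ZMod n) : greedyStep S a ⊆ S := by
  rcases greedyStep_cases S a with ⟨h, -⟩ | ⟨p, -, -, -, h⟩ <;> rw [h]
  exact Finset.erase_subset _ _

theorem mem_greedyStep_of_notMem_supp {S : Finset (Prp n)} {a : ZMod n} {p : Prp n} (hp : p ∈ S)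
    (ha : a ∉ supp n p) : p ∈ greedyStep S a := by
  rcases greedyStep_cases S a with ⟨h, -⟩ | ⟨q, -, hq, -, h⟩ <;> rw [h]
  · exact hp
  · exact Finset.mem_erase.2 ⟨fun e => ha (e ▸ hq), hp⟩

theorem greedyStep_eq_self {S : Finset (Prp n)} {a : ZMod n} (h : ∀ p ∈ S, a ∉ supp n p) :
    greedyStep S a = S :=
  (greedyStep_subset S a).antisymm fun p hp => mem_greedyStep_of_notMem_supp hp (h p hp)

theorem greedyStep_eq_erase [NeZero n] {S : Finset (Prp n)} {a : ZMod n} {p : Prp n} (hp : p ∈ S)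
    (ha : a ∈ supp n p) (h : ∀ q ∈ S, a ∈ supp n q → cwKey n a q ≤ cwKey n a p) :
    greedyStep S a = S.erase p := by
  rcases greedyStep_cases S a with ⟨-, h'⟩ | ⟨q, hq, hqa, hmax, h'⟩
  · exact absurd ha (h' p hp)
  · rw [h', cwKey_inj ha hqa ((hmax p hp ha).antisymm (h q hq hqa))]

theorem greedyStep_mono [NeZero n] {S S' : Finset (Prp n)} (hS : S ⊆ S') (a : ZMod n) :
    greedyStep S a ⊆ greedyStep S' a := by
  rcases greedyStep_cases S' a with ⟨h', -⟩ | ⟨q, hq, hqa, hmax, h'⟩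
  · rw [h']
    exact (greedyStep_subset S a).trans hS
  · rw [h']
    by_cases hqS : q ∈ S
    · rw [greedyStep_eq_erase hqS hqa fun r hr => hmax r (hS hr)]
      exact Finset.erase_subset_erase _ hS
    · exact fun r hr => Finset.mem_erase.2
        ⟨fun e => hqS (e ▸ greedyStep_subset S a hr), hS (greedyStep_subset S a hr)⟩

theorem greedyStep_insert [NeZero n] {S : Finset (Prp n)} {a : ZMod n} {p : Prp n}
    (ha : a ∉ supp n p) : greedyStep (insert p S) a = insert p (greedyStep S a) := by
  rcases greedyStep_cases S a with ⟨h', h⟩ | ⟨q, hq, hqa, hmax, h'⟩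
  · rw [h']
    refine greedyStep_eq_self fun r hr => ?_
    rcases Finset.mem_insert.1 hr with rfl | hr
    exacts [ha, h r hr]
  · have hqp : p ≠ q := fun e => ha (e ▸ hqa)
    rw [h', greedyStep_eq_erase (Finset.mem_insert_of_mem hq) hqa, Finset.erase_insert_of_ne hqp]
    intro r hr hra
    rcases Finset.mem_insert.1 hr with rfl | hr
    exacts [absurd hra ha, hmax r hr hra]

theorem greedyRun_add (S : Finset (Prp n)) (a : ZMod n) (s t : ℕ) :
    greedyRun S a (s + t) = greedyRun (greedyRun S a s) (a + (s : ZMod n)) t := by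
  induction t with
  | zero => rfl
  | succ t ih =>
    change greedyStep (greedyRun S a (s + t)) (a + ((s + t : ℕ) : ZMod n)) = greedyStep _ _
    rw [ih]
    push_cast
    rw [add_assoc]

theorem greedyRun_succ' (S : Finset (Prp n)) (a : ZMod n) (t : ℕ) :
    greedyRun S a (t + 1) = greedyRun (greedyStep S a) (a + 1) t := by
  rw [add_comm t 1, greedyRun_add]
  simp [greedyRun]

theorem greedyRun_antitone (S : Finset (Prp n)) (a : ZMod n) : Antitone (greedyRun S a) :=
  antitone_nat_of_succ_le fun _ => greedyStep_subset _ _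

theorem greedyRun_subset (S : Finset (Prp n)) (a : ZMod n) (t : ℕ) : greedyRun S a t ⊆ S :=
  greedyRun_antitone S a (Nat.zero_le t)

theorem greedyRun_mono [NeZero n] {S S' : Finset (Prp n)} (hS : S ⊆ S') (a : ZMod n) (t : ℕ) :
    greedyRun S a t ⊆ greedyRun S' a t := by
  induction t with
  | zero => exact hS
  | succ t ih => exact greedyStep_mono ih _

theorem greedyRun_insert [NeZero n] {S : Finset (Prp n)} {a : ZMod n} {p : Prp n} {t : ℕ}
    (h : ∀ s < t, a + (s : ZMod n) ∉ supp n p) :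
    greedyRun (insert p S) a t = insert p (greedyRun S a t) := by
  induction t with
  | zero => rfl
  | succ t ih =>
    change greedyStep _ _ = insert p (greedyStep _ _)
    rw [ih fun s hs => h s (by omega), greedyStep_insert (h t (by omega))]

theorem gnRun_fst (P : Finset (Prp n)) (i : ZMod n) (t : ℕ) :
    (gnRun n P i t).1 = greedyRun P i t := by
  induction t with
  | zero => rfl
  | succ t ih =>
    rw [gnRun, greedyRun, greedyStep, ← ih]
    rcases pickCW n (gnRun n P i t).1 (i + (t : ZMod n)) <;> rfl

theorem gnRun_snd (P : Finset (Prp n)) (i : ZMod n) (t : ℕ) (p : Prp n) (v : ZMod n) :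
    (gnRun n P i t).2 p = some v ↔
      ∃ s < t, pickCW n (greedyRun P i s) (i + (s : ZMod n)) = some p ∧
        v = i + (s : ZMod n) := by
  induction t with
  | zero => simp [gnRun]
  | succ t ih =>
    have hsplit : (∃ s < t + 1, pickCW n (greedyRun P i s) (i + (s : ZMod n)) = some p ∧
        v = i + (s : ZMod n)) ↔ (gnRun n P i t).2 p = some v ∨
          (pickCW n (greedyRun P i t) (i + (t : ZMod n)) = some p ∧ v = i + (t : ZMod n)) := by
      rw [ih]
      constructor
      · rintro ⟨s, hs, h⟩
        rcases Nat.lt_succ_iff_lt_or_eq.1 hs with hs | rfl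
        exacts [Or.inl ⟨s, hs, h⟩, Or.inr h]
      · rintro (⟨s, hs, h⟩ | h)
        exacts [⟨s, by omega, h⟩, ⟨t, by omega, h⟩]
    rw [hsplit, gnRun, ← gnRun_fst]
    rcases hpick : pickCW n (gnRun n P i t).1 (i + (t : ZMod n)) with _ | q
    · simp
    · by_cases hqp : p = q
      · subst hqp
        have hnone : ¬ (gnRun n P i t).2 p = some v := by
          rw [ih]
          rintro ⟨s, hs, hps, -⟩
          have h1 := (pickCW_eq_some hpick).1
          rw [gnRun_fst] at h1
          have h2 := greedyRun_antitone P i (Nat.succ_le_of_lt hs) h1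
          rw [greedyRun, greedyStep, hps] at h2
          simp at h2
        simp only [Function.update_self, hnone, false_or, true_and, Option.some.injEq]
        exact eq_comm
      · simp only [Function.update_of_ne hqp, Option.some.injEq]
        constructor
        · exact Or.inl
        · rintro (h | ⟨h, -⟩)
          exacts [h, absurd h.symm hqp]

theorem mem_gnSet [NeZero n] {P : Finset (Prp n)} {i x : ZMod n} :
    x ∈ gnSet n P i ↔ ∃ p ∈ greedyRun P i (ord n i x), x ∈ supp n p := by
  simp only [gnSet, gnAssign, Finset.mem_filter, Finset.mem_univ, true_and, gnRun_snd]
  constructor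
  · rintro ⟨p, s, hs, hp, rfl⟩
    rw [ord_add_natCast i hs]
    obtain ⟨h1, h2, -⟩ := pickCW_eq_some hp
    exact ⟨p, h1, h2⟩
  · rintro ⟨p, hp, hx⟩
    rcases h : pickCW n (greedyRun P i (ord n i x)) x with _ | q
    · exact absurd hx (pickCW_eq_none h p hp)
    · exact ⟨q, ord n i x, ord_lt i x, by rw [add_ord]; exact h, (add_ord i x).symm⟩

theorem card_gnSet_filter [NeZero n] (P : Finset (Prp n)) (i : ZMod n) {t : ℕ} (ht : t ≤ n) :
    ((gnSet n P i).filter fun x => ord n i x < t).card + (greedyRun P i t).card = P.card := by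
  induction t with
  | zero => simp [greedyRun]
  | succ t ih =>
    specialize ih (by omega)
    have hv : ord n i (i + (t : ZMod n)) = t := ord_add_natCast i (by omega)
    rcases greedyStep_cases (greedyRun P i t) (i + (t : ZMod n)) with ⟨h', h⟩ | ⟨p, hp, hpa, -, h'⟩
    · have hnot : i + (t : ZMod n) ∉ gnSet n P i := by
        rw [mem_gnSet, hv]
        rintro ⟨p, hp, hx⟩
        exact h p hp hx
      rw [greedyRun, h', ← ih]
      congr 2
      refine Finset.filter_congr fun x hx => ?_
      have : ord n i x ≠ t := fun e => hnot (by rw [← e, add_ord]; exact hx)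
      omega
    · have hmem : i + (t : ZMod n) ∈ gnSet n P i := by
        rw [mem_gnSet, hv]
        exact ⟨p, hp, hpa⟩
      have hfil : (gnSet n P i).filter (fun x => ord n i x < t + 1) =
          insert (i + (t : ZMod n)) ((gnSet n P i).filter fun x => ord n i x < t) := by
        ext x
        simp only [Finset.mem_filter, Finset.mem_insert]
        constructor
        · rintro ⟨hx, hlt⟩
          by_cases hxt : ord n i x = t
          · left
            rw [← hxt, add_ord]
          · exact Or.inr ⟨hx, by omega⟩
        · rintro (rfl | ⟨hx, hlt⟩)
          · exact ⟨hmem, by omega⟩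
          · exact ⟨hx, by omega⟩
      have hpos := Finset.card_pos.2 ⟨p, hp⟩
      rw [greedyRun, h', hfil, Finset.card_insert_of_notMem (by simp [hv]),
        Finset.card_erase_of_mem hp]
      omega

theorem card_gnSet [NeZero n] {P : Finset (Prp n)} {i : ZMod n} (h : greedyRun P i n = ∅) :
    (gnSet n P i).card = P.card := by
  have := card_gnSet_filter P i le_rfl
  rw [h, Finset.card_empty, add_zero, Finset.filter_true_of_mem fun x _ => ord_lt i x] at this
  exact this

theorem notMem_gnSet_of_greedyRun_eq_empty [NeZero n] {P : Finset (Prp n)} {i x : ZMod n} {t : ℕ}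
    (h : greedyRun P i t = ∅) (hx : t ≤ ord n i x) : x ∉ gnSet n P i := by
  rw [mem_gnSet]
  rintro ⟨p, hp, -⟩
  have := greedyRun_antitone P i hx hp
  rw [h] at this
  simp at this

theorem mem_gnSet_of_subset [NeZero n] {S S' : Finset (Prp n)} (hS : S ⊆ S') {i x : ZMod n} {s : ℕ}
    (hx : ord n i x = s + ord n (i + (s : ZMod n)) x) (h : x ∈ gnSet n S i) :
    x ∈ gnSet n S' (i + (s : ZMod n)) := by
  rw [mem_gnSet, hx, greedyRun_add] at h
  obtain ⟨p, hp, hpx⟩ := h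
  exact mem_gnSet.2 ⟨p, greedyRun_mono ((greedyRun_subset S i s).trans hS) _ _ hp, hpx⟩

end Greedy

section Hall

variable {n : ℕ} [NeZero n] {P : Finset (Prp n)}

/-- The ends of a propagator of a dense set are at distance at least `2` in both directions. -/
theorem two_le_ord_of_dense (hd : ∀ Q ⊆ P, Q.Nonempty → Q.card + 3 ≤ (suppSet n Q).card)
    {e j : ZMod n} (hp : s(e, j) ∈ P) : 2 ≤ ord n e j ∧ ord n e j + 2 ≤ n := by
  have h := hd {s(e, j)} (by simpa using hp) (by simp)
  have hs : suppSet n {s(e, j)} = ({e, e + 1, j, j + 1} : Finset (ZMod n)) := by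
    ext x
    simp only [mem_suppSet, Finset.mem_singleton, exists_eq_left, mem_supp, Sym2.mem_iff,
      Finset.mem_insert, or_and_right, exists_or, or_assoc]
  rw [hs, Finset.card_singleton] at h
  have hlt := ord_lt e j
  have h3 : ∀ a b c : ZMod n, ({e, e + 1, j, j + 1} : Finset (ZMod n)) ⊆ {a, b, c} → False := by
    intro a b c hsub
    have := (Finset.card_le_card hsub).trans Finset.card_le_three
    omega
  have h0 : ord n e j ≠ 0 := fun h0 => by
    rw [ord_eq_zero.1 h0] at h3
    exact h3 e (e + 1) e (by intro x; simp; tauto)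
  have h1 : ord n e j ≠ 1 := fun h1 => by
    have : j = e + 1 := by
      rw [← add_ord e j, h1]
      simp
    rw [this] at h3
    exact h3 e (e + 1) (e + 1 + 1) (by intro x; simp)
  have h2 : ord n e j + 1 ≠ n := fun h2 => by
    have h4 := ord_succ e j
    rw [if_pos h2, ord_eq_zero] at h4
    rw [h4] at h3
    exact h3 e (e + 1) j (by intro x; simp; tauto)
  omega

/-- Of two noncrossing propagators, one lies weakly on one side of the other. -/
theorem inside_or_outside {e j : ZMod n} {q : Prp n} (hc : ¬ Crossing n s(e, j) q) :
    (∀ x ∈ q, ord n e x ≤ ord n e j) ∨ ∀ x ∈ q, ord n e x = 0 ∨ ord n e j ≤ ord n e x := by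
  induction q using Sym2.ind with
  | _ k l =>
    by_contra! hcon
    obtain ⟨⟨x, hx, hx'⟩, y, hy, hy0, hy'⟩ := hcon
    refine hc ⟨e, j, y, x, rfl, ?_, Nat.pos_of_ne_zero hy0, hy', hx'⟩
    have hne : x ≠ y := by
      rintro rfl
      omega
    rw [Sym2.mem_iff] at hx hy
    rcases hx with rfl | rfl <;> rcases hy with rfl | rfl <;> simp_all [Sym2.eq_swap]

/-- If `p` is the clockwise-most propagator of `S` on `a`, then every propagator of `S` on `a`
lies inside `p`, where `p` is directed from its clockwise-most end on `a`. -/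
theorem exists_end_of_clockwise_most
    (hd : ∀ Q ⊆ P, Q.Nonempty → Q.card + 3 ≤ (suppSet n Q).card)
    (hc : ∀ p ∈ P, ∀ q ∈ P, ¬ Crossing n p q) {S : Finset (Prp n)} (hS : S ⊆ P) {a : ZMod n}
    {p : Prp n} (hp : p ∈ S) (ha : a ∈ supp n p)
    (hmax : ∀ q ∈ S, a ∈ supp n q → cwKey n a q ≤ cwKey n a p) :
    ∃ e j, p = s(e, j) ∧ (∀ q ∈ S, a ∈ supp n q → ∀ x ∈ q, ord n e x ≤ ord n e j) ∧
      (a = e + 1 ∨ (a = e ∧ ∀ q ∈ S, a ∈ supp n q → a ∈ q)) := by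
  have hend : ∀ r : Prp n, a ∈ supp n r → a - 1 ∉ r → a ∈ r := by
    intro r hr hr'
    obtain ⟨e, he, rfl | rfl⟩ := mem_supp.1 hr
    · exact he
    · simp [he] at hr'
  by_cases h1 : a - 1 ∈ p
  · obtain ⟨j, hj⟩ : ∃ j, p = s(a - 1, j) := ⟨_, otherEnd_spec h1⟩
    refine ⟨a - 1, j, hj, fun q hq hqa => ?_, Or.inl (by ring)⟩
    have h2 := two_le_ord_of_dense hd (hj ▸ hS hp)
    by_cases hq1 : a - 1 ∈ q
    · have hkey := hmax q hq hqa
      rw [cwKey, cwKey, if_pos h1, if_pos hq1, hj, otherEnd_mk] at hkey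
      rw [otherEnd_spec hq1]
      intro x hx
      rcases Sym2.mem_iff.1 hx with rfl | rfl
      · simp
      · omega
    · have hqa' := hend q hqa hq1
      rcases inside_or_outside (hj ▸ hc p (hS hp) q (hS hq)) with h | h
      · exact h
      · have h3 := ord_succ (a - 1) (a - 1)
        have h4 := h a hqa'
        rw [sub_add_cancel, ord_self] at h3
        split_ifs at h3 <;> omega
  · have hpa := hend p ha h1
    have hq1 : ∀ q ∈ S, a ∈ supp n q → a - 1 ∉ q := by
      intro q hq hqa hq1
      have hkey := hmax q hq hqa
      rw [cwKey, cwKey, if_neg h1, if_pos hq1] at hkey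
      have := ord_lt a (otherEnd n p a)
      omega
    obtain ⟨j, hj⟩ : ∃ j, p = s(a, j) := ⟨_, otherEnd_spec hpa⟩
    refine ⟨a, j, hj, fun q hq hqa => ?_,
      Or.inr ⟨rfl, fun q hq hqa => hend q hqa (hq1 q hq hqa)⟩⟩
    have hkey := hmax q hq hqa
    rw [cwKey, cwKey, if_neg h1, if_neg (hq1 q hq hqa), hj, otherEnd_mk] at hkey
    rw [otherEnd_spec (hend q hqa (hq1 q hq hqa))]
    intro x hx
    rcases Sym2.mem_iff.1 hx with rfl | rfl
    · simp
    · omega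

/-- Enlarging a Hall-tight set by the clockwise-most propagator does not create a violation:
either no new vertex is needed, or the set was not tight. -/
theorem card_lt_of_new_vertex
    (hd : ∀ Q ⊆ P, Q.Nonempty → Q.card + 3 ≤ (suppSet n Q).card)
    (hc : ∀ p ∈ P, ∀ q ∈ P, ¬ Crossing n p q) {S : Finset (Prp n)} (hS : S ⊆ P) {a : ZMod n}
    {m : ℕ} (hm : m + 1 < n)
    (hH : ∀ Q ⊆ S, Q.card ≤ ((suppSet n Q).filter fun x => ord n a x < m + 1).card)
    {p : Prp n} (hp : p ∈ S) (ha : a ∈ supp n p)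
    (hmax : ∀ q ∈ S, a ∈ supp n q → cwKey n a q ≤ cwKey n a p)
    {Q : Finset (Prp n)} (hQ : Q ⊆ S) (haQ : a ∈ suppSet n Q)
    {y : ZMod n} (hy : y ∈ supp n p) (hym : ord n a y < m + 1) (hyQ : y ∉ suppSet n Q) :
    Q.card + 1 ≤ ((suppSet n Q).filter fun x => ord n a x < m + 1).card := by
  obtain ⟨e, j, rfl, hin, hae⟩ := exists_end_of_clockwise_most hd hc hS hp ha hmax
  obtain ⟨hJ1, hJ2⟩ := two_le_ord_of_dense hd (hS hp)
  obtain ⟨q₀, hq₀, hq₀a⟩ := mem_suppSet.1 haQ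
  have hya : y ≠ a := fun h => hyQ (h ▸ haQ)
  have hord : (∀ x, ord n a x = ord n e x) ∨
      (a = e + 1 ∧ ∀ x, ord n a x = if ord n e x = 0 then n - 1 else ord n e x - 1) := by
    rcases hae with rfl | ⟨rfl, -⟩
    · exact Or.inr ⟨rfl, ord_succ_left e⟩
    · exact Or.inl fun _ => rfl
  have hj1 : ord n e (j + 1) = ord n e j + 1 := by
    rw [ord_succ, if_neg (by omega)]
  have he1 : ord n e (e + 1) = 1 := by
    rw [ord_succ, ord_self, if_neg (by omega)]
  have hyj : y = j ∨ y = j + 1 := by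
    rcases mem_supp.1 hy with ⟨x, hx, hxy⟩
    rcases Sym2.mem_iff.1 hx with rfl | rfl
    · exfalso
      rcases hae with rfl | ⟨rfl, hmem⟩
      · rcases hxy with rfl | rfl
        · have := ord_succ_left y y
          rw [ord_self, if_pos rfl] at this
          omega
        · exact hya rfl
      · rcases hxy with rfl | rfl
        · exact hya rfl
        · exact hyQ (mem_suppSet.2 ⟨q₀, hq₀, mem_supp.2 ⟨a, hmem q₀ (hQ hq₀) hq₀a, Or.inr rfl⟩⟩)
    · exact hxy
  obtain ⟨y', hyy'⟩ : ∃ y', ∀ x, (x = j ∨ x = j + 1) → x = y ∨ x = y' := by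
    rcases hyj with rfl | rfl
    · exact ⟨y + 1, fun x h => h⟩
    · exact ⟨j, fun x h => h.symm⟩
  have hjm : ord n a j < m + 1 := by
    rcases hyj with rfl | rfl
    · exact hym
    · rcases hord with h | ⟨-, h⟩
      · rw [h, hj1] at hym
        rw [h]
        omega
      · rw [h, hj1, if_neg (by omega)] at hym
        rw [h, if_neg (by omega)]
        omega
  set A := Q.filter fun q => ∀ x ∈ q, ord n e x ≤ ord n e j with hA
  set B := Q.filter fun q => ¬ ∀ x ∈ q, ord n e x ≤ ord n e j with hB
  have hcard : A.card + B.card = Q.card := Finset.card_filter_add_card_filter_not _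
  have hAQ : A ⊆ Q := Finset.filter_subset _ _
  have hBQ : B ⊆ Q := Finset.filter_subset _ _
  have hdA := hd A ((hAQ.trans hQ).trans hS)
    ⟨q₀, Finset.mem_filter.2 ⟨hq₀, hin q₀ (hQ hq₀) hq₀a⟩⟩
  have hHB := hH B (hBQ.trans hQ)
  set A' := (suppSet n A \ {a - 1, y'}) with hA'
  have hA'card : A.card + 1 ≤ A'.card := by
    have h1 := Finset.le_card_sdiff ({a - 1, y'} : Finset (ZMod n)) (suppSet n A)
    have h2 : ({a - 1, y'} : Finset (ZMod n)).card ≤ 2 := Finset.card_le_two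
    rw [← hA'] at h1
    omega
  have hA'lt : ∀ x ∈ A', ord n e x < ord n e j ∧ ord n a x < m + 1 ∧ (a = e + 1 → x ≠ e) := by
    intro x hx
    obtain ⟨hxA, hx'⟩ := Finset.mem_sdiff.1 hx
    simp only [Finset.mem_insert, Finset.mem_singleton, not_or] at hx'
    have hxy : x ≠ y := fun h => hyQ (h ▸ suppSet_mono hAQ hxA)
    have hxj : x ≠ j ∧ x ≠ j + 1 := by
      constructor <;> intro h
      · rcases hyy' x (Or.inl h) with h | h
        exacts [hxy h, hx'.2 h]
      · rcases hyy' x (Or.inr h) with h | h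
        exacts [hxy h, hx'.2 h]
    have hxe : a = e + 1 → x ≠ e := by
      rintro rfl rfl
      exact hx'.1 (by ring)
    obtain ⟨q, hq, hxq⟩ := mem_suppSet.1 hxA
    obtain ⟨k, hk, hxk⟩ := mem_supp.1 hxq
    have hkJ := (Finset.mem_filter.1 hq).2 k hk
    have hle : ord n e x ≤ ord n e j + 1 := by
      rcases hxk with rfl | rfl
      · omega
      · rw [ord_succ]
        split_ifs <;> omega
    have hn1 : ord n e x ≠ ord n e j := fun h => hxj.1 (ord_inj.1 h)
    have hn2 : ord n e x ≠ ord n e j + 1 := fun h => hxj.2 (ord_inj.1 (h.trans hj1.symm))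
    have hn3 : a = e + 1 → ord n e x ≠ 0 := fun h h' => hxe h (ord_eq_zero.1 h')
    refine ⟨by omega, ?_, hxe⟩
    rcases hord with h | ⟨h1, h⟩
    · rw [h] at hjm ⊢
      omega
    · rw [h, if_neg (by omega)] at hjm
      rw [h, if_neg (hn3 h1)]
      omega
  have hdisj : Disjoint A' ((suppSet n B).filter fun x => ord n a x < m + 1) := by
    rw [Finset.disjoint_left]
    intro x hxA hxB
    obtain ⟨hx1, -, hx3⟩ := hA'lt x hxA
    obtain ⟨q, hq, hxq⟩ := mem_suppSet.1 (Finset.mem_filter.1 hxB).1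
    obtain ⟨hqQ, hqin⟩ := Finset.mem_filter.1 hq
    have hout := (inside_or_outside (hc _ (hS hp) q (hS (hQ hqQ)))).resolve_left hqin
    have hnota : a ∉ supp n q := fun h => hqin (hin q (hQ hqQ) h)
    obtain ⟨k, hk, hxk⟩ := mem_supp.1 hxq
    have hk' := hout k hk
    rcases hxk with rfl | rfl
    · have hxe : x = e := ord_eq_zero.1 (by omega)
      subst hxe
      rcases hae with h | ⟨h, -⟩
      · exact hx3 h rfl
      · exact hnota (h ▸ hxq)
    · rcases hk' with hk' | hk'
      · have hke : k = e := ord_eq_zero.1 hk'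
        subst hke
        rcases hae with h | ⟨h, -⟩
        · exact hnota (h ▸ hxq)
        · exact hnota (mem_supp.2 ⟨k, hk, Or.inl h⟩)
      · rw [ord_succ] at hx1
        split_ifs at hx1 with h4
        · have hxe : k + 1 = e := by
            rw [← ord_eq_zero, ord_succ, if_pos h4]
          rcases hae with h | ⟨h, -⟩
          · exact hx3 h hxe
          · exact hnota (h.trans hxe.symm ▸ hxq)
        · omega
  have hsub : A' ∪ ((suppSet n B).filter fun x => ord n a x < m + 1) ⊆
      (suppSet n Q).filter fun x => ord n a x < m + 1 := by
    refine Finset.union_subset (fun x hx => ?_)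
      (Finset.filter_subset_filter _ (suppSet_mono hBQ))
    exact Finset.mem_filter.2
      ⟨suppSet_mono hAQ (Finset.mem_sdiff.1 hx).1, (hA'lt x hx).2.1⟩
  have := Finset.card_le_card hsub
  rw [Finset.card_union_of_disjoint hdisj] at this
  omega

/-- The greedy step preserves Hall's condition on the vertices still to be visited. -/
theorem hall_greedyStep
    (hd : ∀ Q ⊆ P, Q.Nonempty → Q.card + 3 ≤ (suppSet n Q).card)
    (hc : ∀ p ∈ P, ∀ q ∈ P, ¬ Crossing n p q) {S : Finset (Prp n)} (hS : S ⊆ P) {a : ZMod n}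
    {m : ℕ} (hm : m + 1 < n)
    (hH : ∀ Q ⊆ S, Q.card ≤ ((suppSet n Q).filter fun x => ord n a x < m + 1).card) :
    ∀ Q ⊆ greedyStep S a,
      Q.card ≤ ((suppSet n Q).filter fun x => ord n (a + 1) x < m).card := by
  intro Q hQ
  have hlt : ∀ x, ord n (a + 1) x < m ↔ x ≠ a ∧ ord n a x < m + 1 := by
    intro x
    rw [ord_succ_left, Ne, ← ord_eq_zero]
    split_ifs <;> omega
  have hfil : ((suppSet n Q).filter fun x => ord n (a + 1) x < m) =
      ((suppSet n Q).filter fun x => ord n a x < m + 1).erase a := by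
    ext x
    simp only [Finset.mem_filter, Finset.mem_erase, hlt]
    tauto
  have hQS := hQ.trans (greedyStep_subset S a)
  rw [hfil]
  by_cases haQ : a ∈ suppSet n Q
  · rcases greedyStep_cases S a with ⟨-, h⟩ | ⟨p, hp, hpa, hmax, h⟩
    · obtain ⟨q, hq, hqa⟩ := mem_suppSet.1 haQ
      exact absurd hqa (h q (hQS hq))
    · rw [Finset.card_erase_of_mem (by simp [haQ])]
      refine Nat.le_sub_one_of_lt ?_
      by_cases hy : ∃ y ∈ supp n p, ord n a y < m + 1 ∧ y ∉ suppSet n Q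
      · obtain ⟨y, hy1, hy2, hy3⟩ := hy
        exact card_lt_of_new_vertex hd hc hS hm hH hp hpa hmax hQS haQ hy1 hy2 hy3
      · push Not at hy
        have hpQ : p ∉ Q := fun hpQ => by simpa [h] using hQ hpQ
        have := hH (insert p Q) (Finset.insert_subset hp hQS)
        rw [Finset.card_insert_of_notMem hpQ] at this
        refine lt_of_lt_of_le this (Finset.card_le_card fun x hx => ?_)
        obtain ⟨hx1, hx2⟩ := Finset.mem_filter.1 hx
        refine Finset.mem_filter.2 ⟨?_, hx2⟩
        obtain ⟨q, hq, hxq⟩ := mem_suppSet.1 hx1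
        rcases Finset.mem_insert.1 hq with rfl | hq
        · exact hy x hxq hx2
        · exact mem_suppSet.2 ⟨q, hq, hxq⟩
  · rw [Finset.erase_eq_of_notMem (by simp [haQ])]
    exact hH Q hQS

/-- The Grassmann necklace algorithm deletes every propagator before it visits the last three
vertices. -/
theorem greedyRun_eq_empty
    (hd : ∀ Q ⊆ P, Q.Nonempty → Q.card + 3 ≤ (suppSet n Q).card)
    (hc : ∀ p ∈ P, ∀ q ∈ P, ¬ Crossing n p q) (hn : 3 ≤ n) (i : ZMod n) :
    greedyRun P i (n - 3) = ∅ := by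
  have key : ∀ t m, t + m = n - 3 → ∀ Q ⊆ greedyRun P i t,
      Q.card ≤ ((suppSet n Q).filter fun x => ord n (i + (t : ZMod n)) x < m).card := by
    intro t
    induction t with
    | zero =>
      intro m hm Q hQ
      rcases Q.eq_empty_or_nonempty with rfl | hne
      · simp
      have h1 := hd Q hQ hne
      have h2 := Finset.card_filter_add_card_filter_not (s := suppSet n Q)
        (fun x => ord n (i + ((0 : ℕ) : ZMod n)) x < m)
      have h3 : ((suppSet n Q).filter fun x => ¬ ord n (i + ((0 : ℕ) : ZMod n)) x < m).card ≤
          (Finset.Ico m n).card := by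
        refine Finset.card_le_card_of_injOn (ord n (i + ((0 : ℕ) : ZMod n))) ?_ ?_
        · intro x hx
          have := (Finset.mem_filter.1 hx).2
          have := ord_lt (i + ((0 : ℕ) : ZMod n)) x
          simp only [Finset.coe_Ico, Set.mem_Ico]
          omega
        · exact fun x _ y _ h => ord_inj.1 h
      rw [Nat.card_Ico] at h3
      omega
    | succ t ih =>
      intro m hm
      have := hall_greedyStep hd hc (greedyRun_subset P i t) (by omega) (ih (m + 1) (by omega))
      rw [add_assoc, ← Nat.cast_one, ← Nat.cast_add] at this
      exact this
  have := key (n - 3) 0 (by omega) _ subset_rfl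
  simpa using this

end Hall

section HardCase

set_option linter.unusedSectionVars false

variable {n : ℕ} [NeZero n]

theorem val_neg_natCast {k : ℕ} (hk : 0 < k) (hkn : k ≤ n) : (-(k : ZMod n)).val = n - k := by
  have : -(k : ZMod n) = ((n - k : ℕ) : ZMod n) := by
    rw [Nat.cast_sub hkn]
    simp
  rw [this, ZMod.val_natCast, Nat.mod_eq_of_lt (by omega)]

theorem card_le_card_greedyStep (S : Finset (Prp n)) (a : ZMod n) :
    S.card ≤ (greedyStep S a).card + 1 := by
  rcases greedyStep_cases S a with ⟨h, -⟩ | ⟨p, hp, -, -, h⟩ <;> rw [h]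
  · omega
  · rw [Finset.card_erase_of_mem hp]
    omega

theorem mem_gnSet_iff_of_greedyRun_eq {S S' : Finset (Prp n)} {i j x : ZMod n} {s : ℕ}
    (h : greedyRun S i s = S') (hj : i + (s : ZMod n) = j) (hx : ord n i x = s + ord n j x) :
    x ∈ gnSet n S i ↔ x ∈ gnSet n S' j := by
  rw [mem_gnSet, mem_gnSet, hx, greedyRun_add, h, hj]

/-- The local configuration around the edges `n - 5, …, n - 1` in the hard case: `p = (n-3, n-1)`
is added to `V`, which consists of `q = (n-5, n-3)` and `U`, where no propagator of `U` is
supported on `n - 3` or `n - 2` and some `r ∈ U` ends on the edge `n - 1`. -/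
structure HardCase (W V U : Finset (Prp n)) (p q r : Prp n) : Prop where
  seven_le : 7 ≤ n
  W_eq : W = insert p V
  V_eq : V = insert q U
  p_notMem : p ∉ V
  q_notMem : q ∉ U
  supp_p : ∀ x : ZMod n, x ∈ supp n p ↔ n - 3 ≤ x.val ∨ x.val = 0
  supp_q : ∀ x : ZMod n, x ∈ supp n q ↔ n - 5 ≤ x.val ∧ x.val ≤ n - 2
  U_free : ∀ u ∈ U, (-3 : ZMod n) ∉ supp n u ∧ (-2 : ZMod n) ∉ supp n u
  r_mem : r ∈ U
  r_supp : (-1 : ZMod n) ∈ supp n r ∧ (0 : ZMod n) ∈ supp n r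
  W_empty : ∀ i, greedyRun W i (n - 3) = ∅
  V_empty : ∀ i, greedyRun V i (n - 3) = ∅
  step_W : greedyStep W (-2) = insert p U
  step_pU : greedyStep (insert p U) (-1) = U

namespace HardCase

variable {W V U : Finset (Prp n)} {p q r : Prp n}

theorem val_one (hn : 7 ≤ n) : (1 : ZMod n).val = 1 := by
  have : Fact (1 < n) := ⟨by omega⟩
  exact ZMod.val_one n

theorem val_neg (hn : 7 ≤ n) : (-1 : ZMod n).val = n - 1 ∧ (-2 : ZMod n).val = n - 2 ∧
    (-3 : ZMod n).val = n - 3 ∧ (-4 : ZMod n).val = n - 4 ∧ (-5 : ZMod n).val = n - 5 := by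
  have h1 := val_neg_natCast (n := n) (k := 1) (by omega) (by omega)
  have h2 := val_neg_natCast (n := n) (k := 2) (by omega) (by omega)
  have h3 := val_neg_natCast (n := n) (k := 3) (by omega) (by omega)
  have h4 := val_neg_natCast (n := n) (k := 4) (by omega) (by omega)
  have h5 := val_neg_natCast (n := n) (k := 5) (by omega) (by omega)
  push_cast at h1 h2 h3 h4 h5
  exact ⟨h1, h2, h3, h4, h5⟩

theorem eq_of_val {x y : ZMod n} (h : x.val = y.val) : x = y := ZMod.val_injective n h

theorem ord_val_eq {i x : ZMod n} {v : ℕ} (h : i.val = v) :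
    ord n i x = if v ≤ x.val then x.val - v else n + x.val - v := by
  rw [ord_eq, h]

variable (H : HardCase W V U p q r)
include H

theorem U_subset_V : U ⊆ V := H.V_eq ▸ Finset.subset_insert q U

theorem q_mem_V : q ∈ V := H.V_eq ▸ Finset.mem_insert_self q U

theorem erase_V : V.erase q = U := by
  rw [H.V_eq, Finset.erase_insert H.q_notMem]

theorem eq_q_of_mem {x : ZMod n} (hx : x = -3 ∨ x = -2) {s : Prp n} (hs : s ∈ V)
    (h : x ∈ supp n s) : s = q := by
  rw [H.V_eq] at hs
  rcases Finset.mem_insert.1 hs with rfl | hs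
  · rfl
  · have := H.U_free s hs
    rcases hx with rfl | rfl
    exacts [absurd h this.1, absurd h this.2]

theorem mem_supp_q {x : ZMod n} (hx : x = -3 ∨ x = -2) : x ∈ supp n q := by
  obtain ⟨-, h2, h3, -, -⟩ := val_neg H.seven_le
  have := H.seven_le
  rw [H.supp_q]
  rcases hx with rfl | rfl <;> omega

theorem mem_supp_p {x : ZMod n} (hx : x = -3 ∨ x = -2) : x ∈ supp n p := by
  obtain ⟨-, h2, h3, -, -⟩ := val_neg H.seven_le
  rw [H.supp_p]
  rcases hx with rfl | rfl <;> omega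

theorem step_V {x : ZMod n} (hx : x = -3 ∨ x = -2) : greedyStep V x = U := by
  rw [greedyStep_eq_erase H.q_mem_V (H.mem_supp_q hx), H.erase_V]
  intro s hs hsx
  rw [H.eq_q_of_mem hx hs hsx]

theorem step_U {x : ZMod n} (hx : x = -3 ∨ x = -2) : greedyStep U x = U := by
  refine greedyStep_eq_self fun u hu => ?_
  rcases hx with rfl | rfl
  exacts [(H.U_free u hu).1, (H.U_free u hu).2]

theorem step_insert_p : greedyStep (insert p U) (-2) = U := by
  have hpU : p ∉ U := fun h => H.p_notMem (H.U_subset_V h)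
  rw [greedyStep_eq_erase (Finset.mem_insert_self p U) (H.mem_supp_p (Or.inr rfl)),
    Finset.erase_insert hpU]
  intro s hs hsx
  rcases Finset.mem_insert.1 hs with rfl | hs
  exacts [le_rfl, absurd hsx (H.U_free s hs).2]

theorem run_V_neg_three : greedyRun V (-3) 2 = U := by
  rw [greedyRun_succ', H.step_V (Or.inl rfl), greedyRun_succ']
  norm_num [greedyRun]
  exact H.step_U (Or.inr rfl)

theorem run_V_neg_two : greedyRun V (-2) 1 = U := by
  rw [greedyRun_succ', H.step_V (Or.inr rfl), greedyRun]

theorem run_W_neg_three : greedyRun W (-3) 2 = U := by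
  rw [greedyRun_succ', greedyRun_succ']
  norm_num [greedyRun]
  have hqW : q ∈ W := by
    rw [H.W_eq]
    exact Finset.mem_insert_of_mem H.q_mem_V
  rcases greedyStep_cases W (-3) with ⟨-, h⟩ | ⟨s, hs, hsx, -, h⟩
  · exact absurd (H.mem_supp_q (Or.inl rfl)) (h q hqW)
  · rw [h]
    rw [H.W_eq] at hs
    rcases Finset.mem_insert.1 hs with rfl | hs
    · rw [H.W_eq, Finset.erase_insert H.p_notMem]
      exact H.step_V (Or.inr rfl)
    · have hsq := H.eq_q_of_mem (Or.inl rfl) hs hsx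
      have hne : p ≠ q := fun e => H.p_notMem (e ▸ H.q_mem_V)
      rw [hsq, H.W_eq, Finset.erase_insert_of_ne hne, H.erase_V]
      exact H.step_insert_p

theorem run_W_neg_two : greedyRun W (-2) 2 = U := by
  rw [greedyRun_succ', greedyRun_succ', H.step_W]
  norm_num [greedyRun]
  exact H.step_pU

theorem run_V_one : greedyRun V 1 (n - 4) = ∅ := by
  have hn := H.seven_le
  have h1 := H.W_empty 1
  have hsup : ∀ s < n - 4, (1 : ZMod n) + (s : ZMod n) ∉ supp n p := by
    intro s hs
    have := ord_add_natCast (1 : ZMod n) (show s < n by omega)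
    rw [ord_val_eq (val_one hn)] at this
    rw [H.supp_p]
    split_ifs at this <;> omega
  rw [show n - 3 = n - 4 + 1 by omega, greedyRun, H.W_eq, greedyRun_insert hsup] at h1
  have h2 := card_le_card_greedyStep (insert p (greedyRun V 1 (n - 4))) (1 + ((n - 4 : ℕ) : ZMod n))
  rw [h1, Finset.card_insert_of_notMem fun h => H.p_notMem (greedyRun_subset V 1 _ h),
    Finset.card_empty] at h2
  exact Finset.card_eq_zero.1 (by omega)

theorem run_W_one {t : ℕ} (ht : t ≤ n - 4) : greedyRun W 1 t = insert p (greedyRun V 1 t) := by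
  have hn := H.seven_le
  rw [H.W_eq, greedyRun_insert]
  intro s hs
  have := ord_add_natCast (1 : ZMod n) (show s < n by omega)
  rw [ord_val_eq (val_one hn)] at this
  rw [H.supp_p]
  split_ifs at this <;> omega

theorem val_of_mem_gnSet_V_one {x : ZMod n} (hx : x ∈ gnSet n V 1) :
    1 ≤ x.val ∧ x.val ≤ n - 4 := by
  have hn := H.seven_le
  by_contra hcon
  refine notMem_gnSet_of_greedyRun_eq_empty H.run_V_one ?_ hx
  rw [ord_val_eq (val_one hn)]
  split_ifs <;> omega

theorem gnSet_W_one : gnSet n W 1 = insert (-3) (gnSet n V 1) := by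
  have hn := H.seven_le
  obtain ⟨-, h2, h3, -, -⟩ := val_neg hn
  ext x
  rw [Finset.mem_insert]
  have hox := ord_val_eq (x := x) (val_one hn)
  have hxl := x.val_lt
  rcases lt_trichotomy (ord n 1 x) (n - 4) with h | h | h
  · have hxp : x ∉ supp n p := by
      rw [H.supp_p]
      split_ifs at hox <;> omega
    have hx3 : x ≠ -3 := by
      rintro rfl
      split_ifs at hox <;> omega
    rw [mem_gnSet, mem_gnSet, H.run_W_one h.le]
    simp [hxp, hx3]
  · have hx3 : x = -3 := eq_of_val (by split_ifs at hox <;> omega)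
    simp only [hx3, true_or, iff_true]
    rw [mem_gnSet]
    rw [hx3] at h
    rw [h, H.run_W_one le_rfl]
    exact ⟨p, Finset.mem_insert_self _ _, H.mem_supp_p (Or.inl rfl)⟩
  · have hx3 : x ≠ -3 := by
      rintro rfl
      split_ifs at hox <;> omega
    have h5 := notMem_gnSet_of_greedyRun_eq_empty (H.W_empty 1) (x := x) (by omega)
    have h6 := notMem_gnSet_of_greedyRun_eq_empty H.run_V_one (x := x) (by omega)
    simp [hx3, h5, h6]

theorem neg_one_mem_X : (-1 : ZMod n) ∈ gnSet n U (-1) := by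
  rw [mem_gnSet, ord_self]
  exact ⟨r, H.r_mem, H.r_supp.1⟩

theorem zero_mem_Y : (0 : ZMod n) ∈ gnSet n U 0 := by
  rw [mem_gnSet, ord_self]
  exact ⟨r, H.r_mem, H.r_supp.2⟩

theorem notMem_gnSet_U {x : ZMod n} (hx : x = -3 ∨ x = -2) (i : ZMod n) : x ∉ gnSet n U i := by
  rw [mem_gnSet]
  rintro ⟨u, hu, hux⟩
  have := H.U_free u (greedyRun_subset U i _ hu)
  rcases hx with rfl | rfl
  exacts [this.1 hux, this.2 hux]

theorem run_U_neg_one : greedyRun U (-1) (n - 4) = ∅ := by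
  have h := H.V_empty (-2)
  rw [show n - 3 = 1 + (n - 4) by have := H.seven_le; omega, greedyRun_add, H.run_V_neg_two] at h
  norm_num at h
  exact h

theorem run_U_zero : greedyRun U 0 (n - 5) = ∅ := by
  have h := H.W_empty (-2)
  rw [show n - 3 = 2 + (n - 5) by have := H.seven_le; omega, greedyRun_add, H.run_W_neg_two] at h
  norm_num at h
  exact h

theorem val_of_mem_X {x : ZMod n} (hx : x ∈ gnSet n U (-1)) :
    x.val + 6 ≤ n ∨ x.val = n - 1 := by
  have hn := H.seven_le
  by_contra hcon
  refine notMem_gnSet_of_greedyRun_eq_empty H.run_U_neg_one ?_ hx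
  rw [ord_val_eq (val_neg hn).1]
  have := x.val_lt
  split_ifs <;> omega

theorem val_of_mem_Y {x : ZMod n} (hx : x ∈ gnSet n U 0) : x.val + 6 ≤ n := by
  have hn := H.seven_le
  by_contra hcon
  refine notMem_gnSet_of_greedyRun_eq_empty H.run_U_zero ?_ hx
  rw [ord_val_eq ZMod.val_zero]
  split_ifs <;> omega

theorem gnSet_V_neg_three : gnSet n V (-3) = insert (-3) (gnSet n U (-1)) := by
  have hn := H.seven_le
  obtain ⟨h1, h2, h3, -, -⟩ := val_neg hn
  ext x
  rw [Finset.mem_insert]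
  by_cases hx3 : x = -3
  · simp only [hx3, true_or, iff_true]
    rw [mem_gnSet, ord_self]
    exact ⟨q, H.q_mem_V, H.mem_supp_q (Or.inl rfl)⟩
  by_cases hx2 : x = -2
  · have : ord n (-3) x = 0 + 1 := by
      rw [hx2, ord_val_eq h3, h2]
      split_ifs <;> omega
    simp only [hx3, hx2 ▸ H.notMem_gnSet_U (Or.inr rfl) (-1), or_false, iff_false]
    rw [mem_gnSet, this, greedyRun_succ', H.step_V (Or.inl rfl), greedyRun]
    rintro ⟨u, hu, hux⟩
    exact (H.U_free u hu).2 (hx2 ▸ hux)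
  · have hv3 : x.val ≠ n - 3 := fun h => hx3 (eq_of_val (h.trans h3.symm))
    have hv2 : x.val ≠ n - 2 := fun h => hx2 (eq_of_val (h.trans h2.symm))
    simp only [hx3, false_or]
    refine mem_gnSet_iff_of_greedyRun_eq H.run_V_neg_three (by norm_num) ?_
    rw [ord_val_eq h3, ord_val_eq h1]
    have := x.val_lt
    split_ifs <;> omega

theorem gnSet_V_neg_two : gnSet n V (-2) = insert (-2) (gnSet n U (-1)) := by
  have hn := H.seven_le
  obtain ⟨h1, h2, -, -, -⟩ := val_neg hn
  ext x
  rw [Finset.mem_insert]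
  by_cases hx2 : x = -2
  · simp only [hx2, true_or, iff_true]
    rw [mem_gnSet, ord_self]
    exact ⟨q, H.q_mem_V, H.mem_supp_q (Or.inr rfl)⟩
  · have hv2 : x.val ≠ n - 2 := fun h => hx2 (eq_of_val (h.trans h2.symm))
    simp only [hx2, false_or]
    refine mem_gnSet_iff_of_greedyRun_eq H.run_V_neg_two (by norm_num) ?_
    rw [ord_val_eq h2, ord_val_eq h1]
    have := x.val_lt
    split_ifs <;> omega

/-- If `U` is exhausted before `n - 5` is visited, adding `q` only adds the vertex `n - 5`. -/
theorem gnSet_V_of_run_U {i : ZMod n} (hi : i = -1 ∨ i = 0)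
    (hU : greedyRun U i (ord n i (-5)) = ∅) : gnSet n V i = insert (-5) (gnSet n U i) := by
  have hn := H.seven_le
  obtain ⟨h1, -, -, -, h5⟩ := val_neg hn
  have hival : i.val = n - 1 ∨ i.val = 0 := by
    rcases hi with rfl | rfl
    exacts [Or.inl h1, Or.inr ZMod.val_zero]
  have hq : ∀ t < ord n i (-5) + 1, t ≠ ord n i (-5) → i + (t : ZMod n) ∉ supp n q := by
    intro t ht ht'
    have hlt := ord_lt i (-5)
    have := ord_add_natCast i (show t < n by omega)
    rw [ord_val_eq rfl] at this
    rw [ord_val_eq rfl, h5] at ht ht'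
    have hv := (i + (t : ZMod n)).val_lt
    rw [H.supp_q]
    rcases hival with h | h <;> rw [h] at this ht ht' <;> split_ifs at this ht ht' <;> omega
  have hrun : ∀ t ≤ ord n i (-5), greedyRun V i t = insert q (greedyRun U i t) := by
    intro t ht
    rw [H.V_eq]
    exact greedyRun_insert fun s hs => hq s (by omega) (by omega)
  have hq5 : (-5 : ZMod n) ∈ supp n q := by
    rw [H.supp_q]
    omega
  ext x
  rw [Finset.mem_insert]
  rcases lt_trichotomy (ord n i x) (ord n i (-5)) with h | h | h
  · have hx5 : x ≠ -5 := fun e => by simp [e] at h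
    have hxq : x ∉ supp n q := by
      have := hq (ord n i x) (by omega) (by omega)
      rwa [add_ord] at this
    rw [mem_gnSet, mem_gnSet, hrun _ h.le]
    simp [hx5, hxq]
  · have hx5 : x = -5 := ord_inj.1 h
    simp only [hx5, true_or, iff_true]
    rw [mem_gnSet, hrun _ le_rfl]
    exact ⟨q, Finset.mem_insert_self _ _, hq5⟩
  · have hx5 : x ≠ -5 := fun e => by simp [e] at h
    have hV : greedyRun V i (ord n i (-5) + 1) = ∅ := by
      rw [greedyRun, hrun _ le_rfl, hU, add_ord]
      rw [greedyStep_eq_erase (Finset.mem_insert_self q ∅) hq5 (by simp)]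
      simp
    have h5 := notMem_gnSet_of_greedyRun_eq_empty hV (x := x) h
    have h6 := notMem_gnSet_of_greedyRun_eq_empty hU h.le
    simp [hx5, h5, h6]

theorem gnSet_V_neg_one : gnSet n V (-1) = insert (-5) (gnSet n U (-1)) := by
  have hn := H.seven_le
  obtain ⟨h1, -, -, -, h5⟩ := val_neg hn
  refine H.gnSet_V_of_run_U (Or.inl rfl) ?_
  rw [← H.run_U_neg_one, ord_val_eq h1, h5]
  congr 1
  split_ifs <;> omega

theorem gnSet_V_zero : gnSet n V 0 = insert (-5) (gnSet n U 0) := by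
  obtain ⟨-, -, -, -, h5⟩ := val_neg H.seven_le
  refine H.gnSet_V_of_run_U (Or.inr rfl) ?_
  rw [← H.run_U_zero, ord_val_eq ZMod.val_zero, h5]
  simp

theorem gnSet_W_neg_three : gnSet n W (-3) = insert (-3) (insert (-2) (gnSet n U (-1))) := by
  have hn := H.seven_le
  obtain ⟨h1, h2, h3, -, -⟩ := val_neg hn
  have hqW : q ∈ W := by
    rw [H.W_eq]
    exact Finset.mem_insert_of_mem H.q_mem_V
  have hpW : p ∈ W := by
    rw [H.W_eq]
    exact Finset.mem_insert_self _ _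
  ext x
  rw [Finset.mem_insert, Finset.mem_insert]
  by_cases hx3 : x = -3
  · simp only [hx3, true_or, iff_true]
    rw [mem_gnSet, ord_self]
    exact ⟨q, hqW, H.mem_supp_q (Or.inl rfl)⟩
  by_cases hx2 : x = -2
  · simp only [hx2, true_or, or_true, iff_true]
    have : ord n (-3) (-2) = 0 + 1 := by
      rw [ord_val_eq h3, h2]
      split_ifs <;> omega
    rw [mem_gnSet, this, greedyRun_succ', greedyRun]
    rcases greedyStep_cases W (-3) with ⟨h, -⟩ | ⟨s, hs, hsx, -, h⟩ <;> rw [h]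
    · exact ⟨q, hqW, H.mem_supp_q (Or.inr rfl)⟩
    · by_cases hsp : s = p
      · refine ⟨q, Finset.mem_erase.2 ⟨?_, hqW⟩, H.mem_supp_q (Or.inr rfl)⟩
        rw [hsp]
        exact fun e => H.p_notMem (e ▸ H.q_mem_V)
      · exact ⟨p, Finset.mem_erase.2 ⟨Ne.symm hsp, hpW⟩, H.mem_supp_p (Or.inr rfl)⟩
  · have hv3 : x.val ≠ n - 3 := fun h => hx3 (eq_of_val (h.trans h3.symm))
    have hv2 : x.val ≠ n - 2 := fun h => hx2 (eq_of_val (h.trans h2.symm))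
    simp only [hx3, hx2, false_or]
    refine mem_gnSet_iff_of_greedyRun_eq H.run_W_neg_three (by norm_num) ?_
    rw [ord_val_eq h3, ord_val_eq h1]
    have := x.val_lt
    split_ifs <;> omega

theorem gnSet_W_neg_two : gnSet n W (-2) = insert (-2) (insert (-1) (gnSet n U 0)) := by
  have hn := H.seven_le
  obtain ⟨h1, h2, -, -, -⟩ := val_neg hn
  have hpW : p ∈ W := by
    rw [H.W_eq]
    exact Finset.mem_insert_self _ _
  ext x
  rw [Finset.mem_insert, Finset.mem_insert]
  by_cases hx2 : x = -2
  · simp only [hx2, true_or, iff_true]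
    rw [mem_gnSet, ord_self]
    exact ⟨p, hpW, H.mem_supp_p (Or.inr rfl)⟩
  by_cases hx1 : x = -1
  · simp only [hx1, true_or, or_true, iff_true]
    have : ord n (-2) (-1) = 0 + 1 := by
      rw [ord_val_eq h2, h1]
      split_ifs <;> omega
    rw [mem_gnSet, this, greedyRun_succ', greedyRun, H.step_W]
    exact ⟨r, Finset.mem_insert_of_mem H.r_mem, H.r_supp.1⟩
  · have hv1 : x.val ≠ n - 1 := fun h => hx1 (eq_of_val (h.trans h1.symm))
    have hv2 : x.val ≠ n - 2 := fun h => hx2 (eq_of_val (h.trans h2.symm))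
    simp only [hx1, hx2, false_or]
    refine mem_gnSet_iff_of_greedyRun_eq H.run_W_neg_two (by norm_num) ?_
    rw [ord_val_eq h2, ord_val_eq ZMod.val_zero]
    have := x.val_lt
    split_ifs <;> omega

theorem mem_gnSet_V_one_of_mem_X {x : ZMod n} (hx : x ∈ gnSet n U (-1)) (h1 : x ≠ -1)
    (h0 : x ≠ 0) : x ∈ gnSet n V 1 := by
  have hn := H.seven_le
  have hv1 : x.val ≠ n - 1 := fun h => h1 (eq_of_val (h.trans (val_neg hn).1.symm))
  have hv0 : x.val ≠ 0 := fun h => h0 (eq_of_val (h.trans ZMod.val_zero.symm))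
  have he : (-1 : ZMod n) + ((2 : ℕ) : ZMod n) = 1 := by norm_num
  have := mem_gnSet_of_subset H.U_subset_V (s := 2) (by
    rw [he, ord_val_eq (val_neg hn).1, ord_val_eq (val_one hn)]
    have := x.val_lt
    split_ifs <;> omega) hx
  rwa [he] at this

theorem mem_gnSet_V_one_of_mem_Y {x : ZMod n} (hx : x ∈ gnSet n U 0) (h0 : x ≠ 0) :
    x ∈ gnSet n V 1 := by
  have hn := H.seven_le
  have hv0 : x.val ≠ 0 := fun h => h0 (eq_of_val (h.trans ZMod.val_zero.symm))
  have he : (0 : ZMod n) + ((1 : ℕ) : ZMod n) = 1 := by norm_num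
  have := mem_gnSet_of_subset H.U_subset_V (s := 1) (by
    rw [he, ord_val_eq ZMod.val_zero, ord_val_eq (val_one hn)]
    have := x.val_lt
    split_ifs <;> omega) hx
  rwa [he] at this

theorem card_gnSet_V (i : ZMod n) : (gnSet n V i).card = U.card + 1 := by
  have h : greedyRun V i n = ∅ := by
    have := greedyRun_antitone V i (Nat.sub_le n 3)
    rw [H.V_empty i] at this
    exact Finset.subset_empty.1 this
  rw [card_gnSet h, H.V_eq, Finset.card_insert_of_notMem H.q_notMem]

theorem neg_two_notMem {m : ZMod n} (hm : m ≠ -2) : (-2 : ZMod n) ∉ gnSet n V m := by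
  have hn := H.seven_le
  have h0 : ord n m (-2) ≠ 0 := fun h => hm (ord_eq_zero.1 h).symm
  have h3 := ord_succ m (-3)
  rw [show (-3 : ZMod n) + 1 = -2 by norm_num] at h3
  split_ifs at h3
  · omega
  rw [mem_gnSet, h3, greedyRun, add_ord]
  rintro ⟨s, hs, hsx⟩
  have hsq := H.eq_q_of_mem (Or.inr rfl) (greedyRun_subset V m _ (greedyStep_subset _ _ hs)) hsx
  subst hsq
  rw [greedyStep_eq_erase (greedyStep_subset _ _ hs) (H.mem_supp_q (Or.inl rfl))] at hs
  · simp at hs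
  · intro s' hs' hsx'
    rw [H.eq_q_of_mem (Or.inl rfl) (greedyRun_subset V m _ hs') hsx']

theorem neg_five_mem {m : ZMod n} (h4 : m ≠ -4) (h3 : m ≠ -3) (h2 : m ≠ -2) :
    (-5 : ZMod n) ∈ gnSet n V m := by
  have hn := H.seven_le
  obtain ⟨-, hv2, hv3, hv4, hv5⟩ := val_neg hn
  have hm4 : m.val ≠ n - 4 := fun h => h4 (eq_of_val (h.trans hv4.symm))
  have hm3 : m.val ≠ n - 3 := fun h => h3 (eq_of_val (h.trans hv3.symm))
  have hm2 : m.val ≠ n - 2 := fun h => h2 (eq_of_val (h.trans hv2.symm))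
  have hml := m.val_lt
  rw [mem_gnSet, H.V_eq, greedyRun_insert]
  · refine ⟨q, Finset.mem_insert_self _ _, ?_⟩
    rw [H.supp_q]
    omega
  · intro s hs
    have hlt := ord_lt m (-5)
    have := ord_add_natCast m (show s < n by omega)
    have hv := (m + (s : ZMod n)).val_lt
    rw [ord_val_eq rfl] at this
    rw [ord_val_eq rfl, hv5] at hs
    rw [H.supp_q]
    split_ifs at this hs <;> omega

theorem neg_five_mem_one : (-5 : ZMod n) ∈ gnSet n V 1 := by
  have hn := H.seven_le
  obtain ⟨-, hv2, hv3, hv4, hv5⟩ := val_neg hn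
  have hv1 := val_one hn
  refine H.neg_five_mem ?_ ?_ ?_ <;> intro h <;> have := congrArg ZMod.val h <;> omega

theorem neg_four_mem : (-4 : ZMod n) ∈ gnSet n V (-4) := by
  have hn := H.seven_le
  obtain ⟨-, hv2, hv3, hv4, hv5⟩ := val_neg hn
  rw [mem_gnSet, ord_self]
  refine ⟨q, H.q_mem_V, ?_⟩
  rw [H.supp_q]
  omega

theorem neg_three_or_neg_one_mem :
    (-3 : ZMod n) ∈ gnSet n V (-4) ∨ (-1 : ZMod n) ∈ gnSet n V (-4) := by
  have hn := H.seven_le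
  obtain ⟨hv1, hv2, hv3, hv4, hv5⟩ := val_neg hn
  have h3 : ord n (-4) (-3) = 0 + 1 := by
    rw [ord_val_eq hv4, hv3]
    split_ifs <;> omega
  have h1 : ord n (-4) (-1) = 0 + 1 + 1 + 1 := by
    rw [ord_val_eq hv4, hv1]
    split_ifs <;> omega
  rw [mem_gnSet, mem_gnSet, h3, h1]
  rw [greedyRun_succ' V (-4) 0, greedyRun_succ' V (-4) (0 + 1 + 1), greedyRun_succ' _ _ (0 + 1),
    greedyRun_succ' _ _ 0, greedyRun, greedyRun, show (-4 : ZMod n) + 1 = -3 by norm_num,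
    show (-3 : ZMod n) + 1 = -2 by norm_num]
  by_cases hq : q ∈ greedyStep V (-4)
  · exact Or.inl ⟨q, hq, H.mem_supp_q (Or.inl rfl)⟩
  · refine Or.inr ⟨r, ?_, H.r_supp.1⟩
    have hrV := H.U_subset_V H.r_mem
    have hrq : r ≠ q := fun e => H.q_notMem (e ▸ H.r_mem)
    have hr : r ∈ greedyStep V (-4) := by
      rcases greedyStep_cases V (-4) with ⟨h, -⟩ | ⟨s, hs, -, -, h⟩
      · rw [h]
        exact hrV
      · rw [h] at hq ⊢
        refine Finset.mem_erase.2 ⟨?_, hrV⟩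
        rintro rfl
        exact hq (Finset.mem_erase.2 ⟨hrq.symm, H.q_mem_V⟩)
    exact mem_greedyStep_of_notMem_supp
      (mem_greedyStep_of_notMem_supp hr (H.U_free r H.r_mem).1) (H.U_free r H.r_mem).2

end HardCase

end HardCase

section Pairing

variable {n : ℕ}

/-- The elements `a ∈ A` and `b ∈ B` are matched when `A` is listed in decreasing and `B` in
increasing `<₁` order. -/
def Paired (A B : Finset (ZMod n)) (a b : ZMod n) : Prop :=
  a ∈ A ∧ b ∈ B ∧
    (A.filter fun x => ord n 1 a < ord n 1 x).card =
      (B.filter fun y => ord n 1 y < ord n 1 b).card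

theorem lePlusAt_iff_paired (I J : Finset (ZMod n)) (a b : ZMod n) :
    LePlusAt n I J a b ↔ Paired (I \ J) (J \ I) a b := Iff.rfl

theorem not_paired_empty (A : Finset (ZMod n)) (a b : ZMod n) : ¬ Paired A ∅ a b := by
  simp [Paired]

theorem paired_insert {A B : Finset (ZMod n)} {a b : ZMod n}
    (ha : ∀ x ∈ A, ord n 1 x < ord n 1 a) (hb : ∀ y ∈ B, ord n 1 b < ord n 1 y) (x y : ZMod n) :
    Paired (insert a A) (insert b B) x y ↔ (x = a ∧ y = b) ∨ Paired A B x y := by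
  have haA : a ∉ A := fun h => lt_irrefl _ (ha a h)
  have hbB : b ∉ B := fun h => lt_irrefl _ (hb b h)
  have hA0 : (insert a A).filter (fun z => ord n 1 a < ord n 1 z) = ∅ := by
    refine Finset.filter_eq_empty_iff.2 fun z hz => ?_
    rcases Finset.mem_insert.1 hz with rfl | hz
    exacts [lt_irrefl _, (ha z hz).not_gt]
  have hB0 : (insert b B).filter (fun z => ord n 1 z < ord n 1 b) = ∅ := by
    refine Finset.filter_eq_empty_iff.2 fun z hz => ?_
    rcases Finset.mem_insert.1 hz with rfl | hz
    exacts [lt_irrefl _, (hb z hz).not_gt]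
  have hA1 : ∀ x ∈ A, ((insert a A).filter fun z => ord n 1 x < ord n 1 z).card =
      (A.filter fun z => ord n 1 x < ord n 1 z).card + 1 := by
    intro x hx
    rw [Finset.filter_insert, if_pos (ha x hx), Finset.card_insert_of_notMem]
    exact fun h => haA (Finset.mem_of_mem_filter a h)
  have hB1 : ∀ y ∈ B, ((insert b B).filter fun z => ord n 1 z < ord n 1 y).card =
      (B.filter fun z => ord n 1 z < ord n 1 y).card + 1 := by
    intro y hy
    rw [Finset.filter_insert, if_pos (hb y hy), Finset.card_insert_of_notMem]
    exact fun h => hbB (Finset.mem_of_mem_filter b h)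
  unfold Paired
  constructor
  · rintro ⟨hx, hy, hxy⟩
    rcases Finset.mem_insert.1 hx with rfl | hx <;> rcases Finset.mem_insert.1 hy with rfl | hy
    · exact Or.inl ⟨rfl, rfl⟩
    · rw [hA0, hB1 y hy, Finset.card_empty] at hxy
      omega
    · rw [hB0, hA1 x hx, Finset.card_empty] at hxy
      omega
    · rw [hA1 x hx, hB1 y hy] at hxy
      exact Or.inr ⟨hx, hy, by omega⟩
  · rintro (⟨rfl, rfl⟩ | ⟨hx, hy, hxy⟩)
    · exact ⟨Finset.mem_insert_self _ _, Finset.mem_insert_self _ _, by rw [hA0, hB0]⟩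
    · refine ⟨Finset.mem_insert_of_mem hx, Finset.mem_insert_of_mem hy, ?_⟩
      rw [hA1 x hx, hB1 y hy, hxy]

theorem Paired.ord_le {A B : Finset (ZMod n)} {a b : ZMod n} (h : Paired A B a b)
    (ha : ∀ x ∈ A, ord n 1 x ≤ ord n 1 a) {y : ZMod n} (hy : y ∈ B) : ord n 1 b ≤ ord n 1 y := by
  have hA : A.filter (fun x => ord n 1 a < ord n 1 x) = ∅ :=
    Finset.filter_eq_empty_iff.2 fun x hx => (ha x hx).not_gt
  have hB := h.2.2
  rw [hA, Finset.card_empty, eq_comm, Finset.card_eq_zero, Finset.filter_eq_empty_iff] at hB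
  exact not_lt.1 (hB hy)

end Pairing

namespace HardCase

section Plusses

set_option linter.unusedSectionVars false

variable {n : ℕ} [NeZero n] {W V U : Finset (Prp n)} {p q r : Prp n}

theorem ord_one_lt_iff (hn : 7 ≤ n) {x y : ZMod n} :
    ord n 1 x < ord n 1 y ↔ x.val ≠ 0 ∧ (y.val = 0 ∨ x.val < y.val) := by
  rw [ord_val_eq (val_one hn), ord_val_eq (val_one hn)]
  have := x.val_lt
  have := y.val_lt
  split_ifs <;> omega

theorem max_lt {c : ZMod n} (hcmax : ∀ x ∈ gnSet n V 1, ord n 1 x ≤ ord n 1 c) {A : Finset (ZMod n)} (hA : A ⊆ gnSet n V 1)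
    (x : ZMod n) (hx : x ∈ A.erase c) :
    ord n 1 x < ord n 1 c := by
  refine lt_of_le_of_ne (hcmax x (hA (Finset.mem_of_mem_erase hx))) fun h => ?_
  exact Finset.ne_of_mem_erase hx (ord_inj.1 h)

variable (H : HardCase W V U p q r)
include H

theorem notMem_gnSet_V_one {x : ZMod n} (h : x.val = 0 ∨ n ≤ x.val + 3) : x ∉ gnSet n V 1 := by
  intro hx
  have := H.seven_le
  have := H.val_of_mem_gnSet_V_one hx
  omega

theorem neg_notMem_gnSet_V_one : (0 : ZMod n) ∉ gnSet n V 1 ∧ (-1 : ZMod n) ∉ gnSet n V 1 ∧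
    (-2 : ZMod n) ∉ gnSet n V 1 ∧ (-3 : ZMod n) ∉ gnSet n V 1 := by
  obtain ⟨h1, h2, h3, -, -⟩ := val_neg H.seven_le
  exact ⟨H.notMem_gnSet_V_one (Or.inl ZMod.val_zero), H.notMem_gnSet_V_one (by omega),
    H.notMem_gnSet_V_one (by omega), H.notMem_gnSet_V_one (by omega)⟩

theorem neg_notMem_X : (-5 : ZMod n) ∉ gnSet n U (-1) ∧ (-4 : ZMod n) ∉ gnSet n U (-1) := by
  have := H.seven_le
  obtain ⟨-, -, -, h4, h5⟩ := val_neg H.seven_le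
  constructor <;> intro h <;> have := H.val_of_mem_X h <;> omega

theorem neg_notMem_Y : (-5 : ZMod n) ∉ gnSet n U 0 ∧ (-4 : ZMod n) ∉ gnSet n U 0 ∧
    (-3 : ZMod n) ∉ gnSet n U 0 := by
  have := H.seven_le
  obtain ⟨-, -, h3, h4, h5⟩ := val_neg H.seven_le
  refine ⟨?_, ?_, ?_⟩ <;> intro h <;> have := H.val_of_mem_Y h <;> omega

theorem sdiff_V_neg_three :
    gnSet n V 1 \ gnSet n V (-3) = gnSet n V 1 \ gnSet n U (-1) ∧
      gnSet n V (-3) \ gnSet n V 1 = insert (-3) (gnSet n U (-1) \ gnSet n V 1) := by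
  obtain ⟨-, -, -, h3⟩ := H.neg_notMem_gnSet_V_one
  rw [H.gnSet_V_neg_three]
  exact ⟨Finset.sdiff_insert_of_notMem h3 _, Finset.insert_sdiff_of_notMem _ h3⟩

theorem sdiff_V_neg_two :
    gnSet n V 1 \ gnSet n V (-2) = gnSet n V 1 \ gnSet n U (-1) ∧
      gnSet n V (-2) \ gnSet n V 1 = insert (-2) (gnSet n U (-1) \ gnSet n V 1) := by
  obtain ⟨-, -, h2, -⟩ := H.neg_notMem_gnSet_V_one
  rw [H.gnSet_V_neg_two]
  exact ⟨Finset.sdiff_insert_of_notMem h2 _, Finset.insert_sdiff_of_notMem _ h2⟩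

theorem sdiff_V_neg_one :
    gnSet n V 1 \ gnSet n V (-1) = (gnSet n V 1 \ gnSet n U (-1)).erase (-5) ∧
      gnSet n V (-1) \ gnSet n V 1 = gnSet n U (-1) \ gnSet n V 1 := by
  rw [H.gnSet_V_neg_one]
  exact ⟨Finset.sdiff_insert _ _ _, Finset.insert_sdiff_of_mem _ H.neg_five_mem_one⟩

theorem sdiff_W_neg_three :
    gnSet n W 1 \ gnSet n W (-3) = gnSet n V 1 \ gnSet n U (-1) ∧
      gnSet n W (-3) \ gnSet n W 1 = insert (-2) (gnSet n U (-1) \ gnSet n V 1) := by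
  obtain ⟨-, -, h2, h3⟩ := H.neg_notMem_gnSet_V_one
  have hX3 := H.notMem_gnSet_U (Or.inl rfl) (-1)
  have h23 : (-2 : ZMod n) ≠ -3 := by
    obtain ⟨-, v2, v3, -, -⟩ := val_neg H.seven_le
    have := H.seven_le
    intro h
    have := congrArg ZMod.val h
    omega
  rw [H.gnSet_W_neg_three, H.gnSet_W_one]
  constructor <;> ext x <;> simp only [Finset.mem_sdiff, Finset.mem_insert] <;> grind

theorem sdiff_W_neg_two :
    gnSet n W 1 \ gnSet n W (-2) = insert (-3) (gnSet n V 1 \ gnSet n U 0) ∧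
      gnSet n W (-2) \ gnSet n W 1 =
        insert (-2) (insert (-1) (gnSet n U 0 \ gnSet n V 1)) := by
  obtain ⟨-, h1, h2, h3⟩ := H.neg_notMem_gnSet_V_one
  have hY3 := H.notMem_gnSet_U (Or.inl rfl) 0
  have h23 : (-2 : ZMod n) ≠ -3 ∧ (-1 : ZMod n) ≠ -3 := by
    obtain ⟨v1, v2, v3, -, -⟩ := val_neg H.seven_le
    have := H.seven_le
    constructor <;> intro h <;> have := congrArg ZMod.val h <;> omega
  rw [H.gnSet_W_neg_two, H.gnSet_W_one]
  constructor <;> ext x <;> simp only [Finset.mem_sdiff, Finset.mem_insert] <;> grind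

theorem Y_sdiff : gnSet n U 0 \ gnSet n V 1 = {0} := by
  ext x
  simp only [Finset.mem_sdiff, Finset.mem_singleton]
  constructor
  · rintro ⟨hx, hx'⟩
    by_contra h0
    exact hx' (H.mem_gnSet_V_one_of_mem_Y hx h0)
  · rintro rfl
    exact ⟨H.zero_mem_Y, H.neg_notMem_gnSet_V_one.1⟩

theorem sdiff_V_zero :
    gnSet n V 0 \ gnSet n V 1 = {0} ∧
      gnSet n V 1 \ gnSet n U 0 = insert (-5) (gnSet n V 1 \ gnSet n V 0) := by
  rw [H.gnSet_V_zero]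
  refine ⟨by rw [Finset.insert_sdiff_of_mem _ H.neg_five_mem_one, H.Y_sdiff], ?_⟩
  rw [Finset.sdiff_insert, Finset.insert_erase]
  exact Finset.mem_sdiff.2 ⟨H.neg_five_mem_one, H.neg_notMem_Y.1⟩

theorem X_sdiff : ∃ B ⊆ ({0} : Finset (ZMod n)),
    gnSet n U (-1) \ gnSet n V 1 = insert (-1) B := by
  refine ⟨(gnSet n U (-1) \ gnSet n V 1).erase (-1), ?_, ?_⟩
  · intro x hx
    simp only [Finset.mem_erase, Finset.mem_sdiff] at hx
    by_contra h0
    exact hx.2.2 (H.mem_gnSet_V_one_of_mem_X hx.2.1 hx.1 fun h => h0 (by simp [h]))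
  · rw [Finset.insert_erase]
    exact Finset.mem_sdiff.2 ⟨H.neg_one_mem_X, H.neg_notMem_gnSet_V_one.2.1⟩

theorem card_V_one_sdiff : (gnSet n V 1 \ gnSet n V 0).card = 1 := by
  rw [Finset.card_sdiff_comm ((H.card_gnSet_V 1).trans (H.card_gnSet_V 0).symm),
    H.sdiff_V_zero.1, Finset.card_singleton]

theorem lePlusAt_V_neg_one (a b : ZMod n) :
    LePlusAt n (gnSet n V 1) (gnSet n V (-1)) a b ↔
      Paired ((gnSet n V 1 \ gnSet n U (-1)).erase (-5)) (gnSet n U (-1) \ gnSet n V 1) a b := by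
  rw [lePlusAt_iff_paired, H.sdiff_V_neg_one.1, H.sdiff_V_neg_one.2]

theorem mem_of_neg_five_notMem {m : ZMod n} (h : (-5 : ZMod n) ∉ gnSet n V m) :
    (m = -4 ∨ m = -3 ∨ m = -2) ∧ m ∈ gnSet n V m := by
  have hm : m = -4 ∨ m = -3 ∨ m = -2 := by
    by_contra! hcon
    exact h (H.neg_five_mem hcon.1 hcon.2.1 hcon.2.2)
  refine ⟨hm, ?_⟩
  rcases hm with rfl | rfl | rfl
  · exact H.neg_four_mem
  · rw [H.gnSet_V_neg_three]
    exact Finset.mem_insert_self _ _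
  · rw [H.gnSet_V_neg_two]
    exact Finset.mem_insert_self _ _

variable {c : ZMod n} (hc : c ∈ gnSet n V 1) (hcmax : ∀ x ∈ gnSet n V 1, ord n 1 x ≤ ord n 1 c)
include hc hcmax

theorem max_eq : c = -4 ∨ c = -5 := by
  have hn := H.seven_le
  obtain ⟨-, -, -, h4, h5⟩ := val_neg hn
  have hcv := H.val_of_mem_gnSet_V_one hc
  have := not_lt.2 (hcmax _ H.neg_five_mem_one)
  rw [ord_one_lt_iff hn, h5] at this
  have : c.val = n - 4 ∨ c.val = n - 5 := by omega
  exact this.imp (fun h => eq_of_val (h.trans h4.symm)) (fun h => eq_of_val (h.trans h5.symm))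

theorem max_mem_sdiff : c ∈ gnSet n V 1 \ gnSet n U (-1) := by
  refine Finset.mem_sdiff.2 ⟨hc, ?_⟩
  rcases H.max_eq hc hcmax with rfl | rfl
  exacts [H.neg_notMem_X.2, H.neg_notMem_X.1]

/-- The largest row is matched with the column `b`, for `b = n - 3` and `b = n - 2`. -/
theorem paired_insert_X {b : ZMod n} (hb : b = -3 ∨ b = -2) (x y : ZMod n) :
    Paired (gnSet n V 1 \ gnSet n U (-1)) (insert b (gnSet n U (-1) \ gnSet n V 1)) x y ↔
      (x = c ∧ y = b) ∨ Paired ((gnSet n V 1 \ gnSet n U (-1)).erase c)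
        (gnSet n U (-1) \ gnSet n V 1) x y := by
  have hn := H.seven_le
  obtain ⟨h1, h2, h3, -, -⟩ := val_neg hn
  conv_lhs => rw [← Finset.insert_erase (H.max_mem_sdiff hc hcmax)]
  refine paired_insert (max_lt hcmax Finset.sdiff_subset) (fun z hz => ?_) x y
  obtain ⟨B, hB, hX⟩ := H.X_sdiff
  rw [hX, Finset.mem_insert] at hz
  rw [ord_one_lt_iff hn]
  rcases hz with rfl | hz
  · rw [h1]
    rcases hb with rfl | rfl <;> omega
  · rw [Finset.mem_singleton.1 (hB hz), ZMod.val_zero]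
    rcases hb with rfl | rfl <;> omega

theorem max_row :
    ((-4 : ZMod n) ∈ gnSet n V 1 \ gnSet n V 0 → c = -4) ∧
      ((-4 : ZMod n) ∉ gnSet n V 1 \ gnSet n V 0 → c = -5) ∧
      (c = -4 → gnSet n V 1 \ gnSet n V 0 = {(-4 : ZMod n)}) := by
  have hn := H.seven_le
  obtain ⟨-, -, -, h4, h5⟩ := val_neg hn
  have h45 : (-4 : ZMod n) ≠ -5 := fun h => by
    have := congrArg ZMod.val h
    omega
  have hmem : c = -4 → (-4 : ZMod n) ∈ gnSet n V 1 \ gnSet n V 0 := by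
    rintro rfl
    refine Finset.mem_sdiff.2 ⟨hc, ?_⟩
    rw [H.gnSet_V_zero, Finset.mem_insert, not_or]
    exact ⟨h45, H.neg_notMem_Y.2.1⟩
  refine ⟨fun h => ?_, fun h => ?_, fun h => ?_⟩
  · refine (H.max_eq hc hcmax).resolve_right ?_
    rintro rfl
    have := not_lt.2 (hcmax _ (Finset.mem_sdiff.1 h).1)
    rw [ord_one_lt_iff hn, h4, h5] at this
    omega
  · exact (H.max_eq hc hcmax).resolve_left fun h' => h (hmem h')
  · obtain ⟨a, ha⟩ := Finset.card_eq_one.1 H.card_V_one_sdiff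
    have := hmem h
    rw [ha, Finset.mem_singleton] at this
    rw [ha, this]

theorem lePlusAt_V_neg_three (a b : ZMod n) :
    LePlusAt n (gnSet n V 1) (gnSet n V (-3)) a b ↔
      (a = c ∧ b = -3) ∨ Paired ((gnSet n V 1 \ gnSet n U (-1)).erase c)
        (gnSet n U (-1) \ gnSet n V 1) a b := by
  rw [lePlusAt_iff_paired, H.sdiff_V_neg_three.1, H.sdiff_V_neg_three.2]
  exact H.paired_insert_X hc hcmax (Or.inl rfl) a b

theorem lePlusAt_V_neg_two (a b : ZMod n) :
    LePlusAt n (gnSet n V 1) (gnSet n V (-2)) a b ↔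
      (a = c ∧ b = -2) ∨ Paired ((gnSet n V 1 \ gnSet n U (-1)).erase c)
        (gnSet n U (-1) \ gnSet n V 1) a b := by
  rw [lePlusAt_iff_paired, H.sdiff_V_neg_two.1, H.sdiff_V_neg_two.2]
  exact H.paired_insert_X hc hcmax (Or.inr rfl) a b

theorem lePlusAt_W_neg_three (a b : ZMod n) :
    LePlusAt n (gnSet n W 1) (gnSet n W (-3)) a b ↔
      (a = c ∧ b = -2) ∨ Paired ((gnSet n V 1 \ gnSet n U (-1)).erase c)
        (gnSet n U (-1) \ gnSet n V 1) a b := by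
  rw [lePlusAt_iff_paired, H.sdiff_W_neg_three.1, H.sdiff_W_neg_three.2]
  exact H.paired_insert_X hc hcmax (Or.inr rfl) a b

theorem lePlusAt_W_neg_three_iff (a b : ZMod n) :
    LePlusAt n (gnSet n W 1) (gnSet n W (-3)) a b ↔
      ((b ≠ -3 ∧ LePlusAt n (gnSet n V 1) (gnSet n V (-3)) a b) ∨
        (b = -2 ∧ LePlusAt n (gnSet n V 1) (gnSet n V (-3)) a (-3))) := by
  have h3 : ∀ A, ¬ Paired A (gnSet n U (-1) \ gnSet n V 1) a (-3) := fun A h =>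
    H.notMem_gnSet_U (Or.inl rfl) (-1) (Finset.mem_sdiff.1 h.2.1).1
  rw [H.lePlusAt_W_neg_three hc hcmax, H.lePlusAt_V_neg_three hc hcmax,
    H.lePlusAt_V_neg_three hc hcmax]
  constructor
  · rintro (⟨rfl, rfl⟩ | h)
    · exact Or.inr ⟨rfl, Or.inl ⟨rfl, rfl⟩⟩
    · refine Or.inl ⟨?_, Or.inr h⟩
      rintro rfl
      exact h3 _ h
  · rintro (⟨hb, ⟨-, rfl⟩ | h⟩ | ⟨rfl, ⟨rfl, -⟩ | h⟩)
    exacts [absurd rfl hb, Or.inr h, Or.inl ⟨rfl, rfl⟩, absurd h (h3 _)]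

theorem lePlusAt_W_neg_two_of_eq_neg_five (h : c = -5) (a b : ZMod n) :
    LePlusAt n (gnSet n W 1) (gnSet n W (-2)) a b ↔
      ((a = -3 ∧ b = -2) ∨ (a = c ∧ b = -1) ∨
        LePlusAt n (gnSet n V 1) (gnSet n V 0) a b) := by
  have hn := H.seven_le
  obtain ⟨h1, h2, h3, h4, h5⟩ := val_neg hn
  rw [lePlusAt_iff_paired, lePlusAt_iff_paired, H.sdiff_W_neg_two.1, H.sdiff_W_neg_two.2,
    H.Y_sdiff, H.sdiff_V_zero.1, H.sdiff_V_zero.2, paired_insert, paired_insert, h]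
  · intro x hx
    rw [← h]
    refine max_lt hcmax Finset.sdiff_subset x (Finset.mem_erase.2 ⟨?_, hx⟩)
    rintro rfl
    rw [H.gnSet_V_zero, h] at hx
    exact (Finset.mem_sdiff.1 hx).2 (Finset.mem_insert_self _ _)
  · intro y hy
    rw [Finset.mem_singleton.1 hy, ord_one_lt_iff hn, h1, ZMod.val_zero]
    omega
  · intro x hx
    have hx1 : x ∈ gnSet n V 1 := by
      rcases Finset.mem_insert.1 hx with rfl | hx
      exacts [H.neg_five_mem_one, (Finset.mem_sdiff.1 hx).1]
    have := H.val_of_mem_gnSet_V_one hx1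
    rw [ord_one_lt_iff hn, h3]
    omega
  · intro y hy
    simp only [Finset.mem_insert, Finset.mem_singleton] at hy
    rw [ord_one_lt_iff hn, h2]
    rcases hy with rfl | rfl
    · omega
    · rw [ZMod.val_zero]
      omega

theorem lePlusAt_W_neg_two_of_eq_neg_four (h : c = -4) (a b : ZMod n) :
    LePlusAt n (gnSet n W 1) (gnSet n W (-2)) a b ↔
      ((a = -3 ∧ b = -2) ∨ (a = -4 ∧ b = -1) ∨ (a = -5 ∧ b = 0)) := by
  have hn := H.seven_le
  obtain ⟨h1, h2, h3, h4, h5⟩ := val_neg hn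
  rw [lePlusAt_iff_paired, H.sdiff_W_neg_two.1, H.sdiff_W_neg_two.2,
    H.Y_sdiff, H.sdiff_V_zero.2, (H.max_row hc hcmax).2.2 h, Finset.pair_comm, paired_insert,
    paired_insert, ← insert_empty_eq (-5 : ZMod n), ← insert_empty_eq (0 : ZMod n), paired_insert]
  · simp only [not_paired_empty, or_false]
  all_goals
    simp only [Finset.mem_insert, Finset.mem_singleton, Finset.notMem_empty, false_implies,
      implies_true, forall_eq_or_imp, forall_eq, ord_one_lt_iff hn, h1, h2, h3, h4, h5,
      ZMod.val_zero, true_or, and_true]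
    try omega

theorem lePlusAt_of_eq_neg_four (h : c = -4) : ∃ A B : Finset (ZMod n), (-5 : ZMod n) ∉ A ∧
    (∀ a b, LePlusAt n (gnSet n V 1) (gnSet n V (-3)) a b ↔
      (a = -4 ∧ b = -3) ∨ (a = -5 ∧ b = -1) ∨ Paired A B a b) ∧
    (∀ a b, LePlusAt n (gnSet n V 1) (gnSet n V (-2)) a b ↔
      (a = -4 ∧ b = -2) ∨ (a = -5 ∧ b = -1) ∨ Paired A B a b) ∧
    (∀ a b, LePlusAt n (gnSet n V 1) (gnSet n V (-1)) a b ↔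
      (a = -4 ∧ b = -1) ∨ Paired A B a b) := by
  have hn := H.seven_le
  obtain ⟨h1, h2, h3, h4, h5⟩ := val_neg hn
  have h54 : (-5 : ZMod n) ≠ -4 := fun h => by
    have := congrArg ZMod.val h
    omega
  obtain ⟨B, hB, hX⟩ := H.X_sdiff
  set D := gnSet n V 1 \ gnSet n U (-1) with hD
  have h5D : (-5 : ZMod n) ∈ D.erase (-4) :=
    Finset.mem_erase.2 ⟨h54, Finset.mem_sdiff.2 ⟨H.neg_five_mem_one, H.neg_notMem_X.1⟩⟩
  have h4D : (-4 : ZMod n) ∈ D.erase (-5) :=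
    Finset.mem_erase.2 ⟨h54.symm, h ▸ H.max_mem_sdiff hc hcmax⟩
  have hval : ∀ x ∈ (D.erase (-4)).erase (-5), x.val ≠ 0 ∧ x.val < n - 5 := by
    intro x hx
    simp only [Finset.mem_erase, hD, Finset.mem_sdiff] at hx
    have hv := H.val_of_mem_gnSet_V_one hx.2.2.1
    have hx5 : x.val ≠ n - 5 := fun e => hx.1 (eq_of_val (e.trans h5.symm))
    have hx4 : x.val ≠ n - 4 := fun e => hx.2.1 (eq_of_val (e.trans h4.symm))
    omega
  have hBl : ∀ y ∈ B, ord n 1 (-1) < ord n 1 y := by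
    intro y hy
    rw [Finset.mem_singleton.1 (hB hy), ord_one_lt_iff hn, h1, ZMod.val_zero]
    omega
  have key : ∀ a b, Paired (D.erase (-4)) (insert (-1) B) a b ↔
      (a = -5 ∧ b = -1) ∨ Paired ((D.erase (-4)).erase (-5)) B a b := by
    intro a b
    conv_lhs => rw [← Finset.insert_erase h5D]
    refine paired_insert (fun x hx => ?_) hBl a b
    have := hval x hx
    rw [ord_one_lt_iff hn]
    omega
  refine ⟨(D.erase (-4)).erase (-5), B, Finset.notMem_erase _ _, fun a b => ?_, fun a b => ?_,
    fun a b => ?_⟩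
  · rw [H.lePlusAt_V_neg_three hc hcmax, hX, h, key]
  · rw [H.lePlusAt_V_neg_two hc hcmax, hX, h, key]
  · rw [H.lePlusAt_V_neg_one, hX, ← hD, Finset.erase_right_comm]
    conv_lhs => rw [← Finset.insert_erase h4D]
    refine paired_insert (fun x hx => ?_) hBl a b
    rw [Finset.erase_right_comm] at hx
    have := hval x hx
    rw [ord_one_lt_iff hn]
    omega

theorem not_lePlusAt_neg_five (h : c = -5) {b : ZMod n} (hb : b = -1 ∨ b = 0) (m : ZMod n) :
    ¬ LePlusAt n (gnSet n V 1) (gnSet n V m) (-5) b := by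
  have hn := H.seven_le
  obtain ⟨h1, h2, h3, h4, h5⟩ := val_neg hn
  intro hP
  obtain ⟨hm, hmm⟩ := H.mem_of_neg_five_notMem (Finset.mem_sdiff.1 hP.1).2
  have hm1 : m ∉ gnSet n V 1 := by
    rcases hm with rfl | rfl | rfl
    · intro h4m
      have := not_lt.2 (hcmax _ h4m)
      rw [h, ord_one_lt_iff hn, h4, h5] at this
      omega
    · exact H.neg_notMem_gnSet_V_one.2.2.2
    · exact H.neg_notMem_gnSet_V_one.2.2.1
  have := not_lt.2 (Paired.ord_le hP (fun x hx => h ▸ hcmax x (Finset.mem_sdiff.1 hx).1)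
    (Finset.mem_sdiff.2 ⟨hmm, hm1⟩))
  rw [ord_one_lt_iff hn] at this
  rcases hb with rfl | rfl <;> [rw [h1] at this; rw [ZMod.val_zero] at this] <;>
    rcases hm with rfl | rfl | rfl <;> omega

theorem not_lePlusAt_neg_five_zero (m : ZMod n) :
    ¬ LePlusAt n (gnSet n V 1) (gnSet n V m) (-5) 0 := by
  rcases H.max_eq hc hcmax with h | h
  swap
  · exact H.not_lePlusAt_neg_five hc hcmax h (Or.inr rfl) m
  have hn := H.seven_le
  obtain ⟨h1, h2, h3, h4, h5⟩ := val_neg hn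
  have h0 : (0 : ZMod n).val = 0 := ZMod.val_zero
  intro hP
  obtain ⟨A, B, hA, hV3, hV2, -⟩ := H.lePlusAt_of_eq_neg_four hc hcmax h
  have hne : (0 : ZMod n) ≠ -1 ∧ (-5 : ZMod n) ≠ -4 := by
    constructor <;> intro h <;> have := congrArg ZMod.val h <;> omega
  obtain ⟨rfl | rfl | rfl, -⟩ :=
    H.mem_of_neg_five_notMem (Finset.mem_sdiff.1 hP.1).2
  · have hmax : ∀ x ∈ gnSet n V 1 \ gnSet n V (-4), ord n 1 x ≤ ord n 1 (-5) := by
      intro x hx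
      rw [Finset.mem_sdiff] at hx
      have hx4 : x.val ≠ n - 4 := fun e =>
        hx.2 ((eq_of_val (e.trans h4.symm) : x = -4) ▸ H.neg_four_mem)
      have := H.val_of_mem_gnSet_V_one hx.1
      rw [← not_lt, ord_one_lt_iff hn]
      omega
    rcases H.neg_three_or_neg_one_mem with hm | hm
    · have := not_lt.2 (Paired.ord_le hP hmax
        (Finset.mem_sdiff.2 ⟨hm, H.neg_notMem_gnSet_V_one.2.2.2⟩))
      rw [ord_one_lt_iff hn] at this
      omega
    · have := not_lt.2 (Paired.ord_le hP hmax
        (Finset.mem_sdiff.2 ⟨hm, H.neg_notMem_gnSet_V_one.2.1⟩))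
      rw [ord_one_lt_iff hn] at this
      omega
  · rcases (hV3 _ _).1 hP with h | h | h
    exacts [hne.2 h.1, hne.1 h.2, hA h.1]
  · rcases (hV2 _ _).1 hP with h | h | h
    exacts [hne.2 h.1, hne.1 h.2, hA h.1]

theorem lePlusAt_V_neg_two_imp (a b : ZMod n)
    (h : LePlusAt n (gnSet n V 1) (gnSet n V (-2)) a b) (hb : b ≠ -2) :
    LePlusAt n (gnSet n V 1) (gnSet n V (-3)) a b := by
  rw [H.lePlusAt_V_neg_two hc hcmax] at h
  exact (H.lePlusAt_V_neg_three hc hcmax a b).2 (Or.inr (h.resolve_left fun h => hb h.2))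

theorem lePlusAt_V_neg_one_imp (a b : ZMod n)
    (h : LePlusAt n (gnSet n V 1) (gnSet n V (-1)) a b) :
    (a = -4 ∧ b = -1) ∨ LePlusAt n (gnSet n V 1) (gnSet n V (-3)) a b := by
  rcases H.max_eq hc hcmax with hc' | hc'
  · obtain ⟨A, B, -, hV3, -, hV1⟩ := H.lePlusAt_of_eq_neg_four hc hcmax hc'
    exact ((hV1 a b).1 h).imp_right fun h => (hV3 a b).2 (Or.inr (Or.inr h))
  · rw [H.lePlusAt_V_neg_one, ← hc'] at h
    exact Or.inr ((H.lePlusAt_V_neg_three hc hcmax a b).2 (Or.inr h))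

theorem exists_lePlusAt_neg_one_iff :
    (∃ m : ZMod n, LePlusAt n (gnSet n V 1) (gnSet n V m) c (-1)) ↔ c = -4 := by
  constructor
  · rintro ⟨m, hm⟩
    refine (H.max_eq hc hcmax).resolve_right fun h => ?_
    rw [h] at hm
    exact H.not_lePlusAt_neg_five hc hcmax h (Or.inl rfl) m hm
  · intro h
    obtain ⟨A, B, -, -, -, hV1⟩ := H.lePlusAt_of_eq_neg_four hc hcmax h
    exact ⟨-1, (hV1 _ _).2 (Or.inl ⟨h, rfl⟩)⟩

end Plusses

end HardCase

section Construction

variable {n : ℕ} [NeZero n] {P : Finset (Prp n)}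

/-- No propagator ends on the middle edge below a propagator of length two. -/
theorem middle_notMem (hd : ∀ Q ⊆ P, Q.Nonempty → Q.card + 3 ≤ (suppSet n Q).card)
    (hc : ∀ p ∈ P, ∀ q ∈ P, ¬ Crossing n p q) (hn : 5 ≤ n) {e : ZMod n} (he : s(e, e + 2) ∈ P)
    {s : Prp n} (hs : s ∈ P) : e + 1 ∉ s := by
  intro h
  have h1 : ord n e (e + 1) = 1 := by
    simpa using ord_add_natCast e (show 1 < n by omega)
  have h2 : ord n e (e + 2) = 2 := by
    simpa using ord_add_natCast e (show 2 < n by omega)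
  rcases inside_or_outside (hc _ he _ hs) with hi | ho
  · obtain ⟨y, rfl⟩ := h
    have hy := hi y (Sym2.mem_mk_right _ _)
    have hey := two_le_ord_of_dense hd hs
    rw [ord_succ_left] at hey
    split_ifs at hey <;> omega
  · have := ho _ h
    omega

theorem exists_hardCase (hadm : IsAdmissible n P) (hp : (s(-3, -1) : Prp n) ∈ P)
    (hedge : (∀ s ∈ P, (-3 : ZMod n) ∈ s → s = (s(-3, -1) : Prp n)) ∨
      ((s(-5, -3) : Prp n) ∈ P ∧ ∀ s ∈ P, (-3 : ZMod n) ∈ s →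
        s = (s(-3, -1) : Prp n) ∨ s = (s(-5, -3) : Prp n)))
    (h2 : (-2 : ZMod n) ∈ gnSet n (eraseP n P) (-2))
    (h1 : (-1 : ZMod n) ∈ gnSet n (eraseP n P) (-2)) :
    ∃ U r, HardCase P (eraseP n P) U (s(-3, -1)) (s(-5, -3)) r := by
  have hcard := hadm.card_add_four_le
  have hn5 : 5 ≤ n := by
    have := Finset.card_pos.2 ⟨_, hp⟩
    omega
  have hVP : eraseP n P ⊆ P := Finset.erase_subset _ _
  have hpV : (s(-3, -1) : Prp n) ∉ eraseP n P := Finset.notMem_erase _ _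
  have hmid2 : ∀ s ∈ P, (-2 : ZMod n) ∉ s := by
    intro s hs
    have := middle_notMem hadm.dense hadm.noncross hn5 (e := -3)
      (by rwa [show (-3 : ZMod n) + 2 = -1 by norm_num]) hs
    rwa [show (-3 : ZMod n) + 1 = -2 by norm_num] at this
  have hsupp2 : ∀ s ∈ P, (-2 : ZMod n) ∈ supp n s → (-3 : ZMod n) ∈ s := by
    intro s hs hs2
    obtain ⟨e, he, h | h⟩ := mem_supp.1 hs2
    · exact absurd (h ▸ he) (hmid2 s hs)
    · rwa [show (-3 : ZMod n) = e by linear_combination h]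
  have hsupp1 : ∀ s ∈ P, (-1 : ZMod n) ∈ supp n s → (-1 : ZMod n) ∈ s := by
    intro s hs hs1
    obtain ⟨e, he, h | h⟩ := mem_supp.1 hs1
    · exact h ▸ he
    · exact absurd (by rwa [show (-2 : ZMod n) = e by linear_combination h]) (hmid2 s hs)
  rw [mem_gnSet, ord_self] at h2
  obtain ⟨s, hsV, hs2⟩ := h2
  have hs3 := hsupp2 s (hVP hsV) hs2
  have hsp : s ≠ s(-3, -1) := fun h => hpV (h ▸ hsV)
  obtain ⟨hq, hon3⟩ := hedge.resolve_left fun h => hsp (h s (hVP hsV) hs3)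
  have hmid4 : ∀ s ∈ P, (-4 : ZMod n) ∉ s := by
    intro s hs
    have := middle_notMem hadm.dense hadm.noncross hn5 (e := -5)
      (by rwa [show (-5 : ZMod n) + 2 = -3 by norm_num]) hs
    rwa [show (-5 : ZMod n) + 1 = -4 by norm_num] at this
  have hpq : (s(-3, -1) : Prp n) ≠ s(-5, -3) := by
    obtain rfl := (hon3 s (hVP hsV) hs3).resolve_left hsp
    exact hsp.symm
  have hqV : (s(-5, -3) : Prp n) ∈ eraseP n P := Finset.mem_erase.2 ⟨hpq.symm, hq⟩
  have v1 := val_neg_natCast (n := n) (k := 1) (by omega) (by omega)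
  have v3 := val_neg_natCast (n := n) (k := 3) (by omega) (by omega)
  have v5 := val_neg_natCast (n := n) (k := 5) (by omega) (by omega)
  push_cast at v1 v3 v5
  rw [mem_gnSet] at h1
  obtain ⟨r, hr, hr1⟩ := h1
  have hrV := greedyRun_subset _ _ _ hr
  have hr1' := hsupp1 r (hVP hrV) hr1
  have hrp : r ≠ s(-3, -1) := fun h => hpV (h ▸ hrV)
  have hrq : r ≠ s(-5, -3) := by
    rintro rfl
    rcases Sym2.mem_iff.1 hr1' with h | h <;> have := congrArg ZMod.val h <;> omega
  have hn : 7 ≤ n := by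
    have h3 : ({s(-3, -1), s(-5, -3), r} : Finset (Prp n)).card = 3 :=
      Finset.card_eq_three.2 ⟨_, _, _, hpq, hrp.symm, hrq.symm, rfl⟩
    have := Finset.card_le_card (show ({s(-3, -1), s(-5, -3), r} : Finset (Prp n)) ⊆ P by
      simp [Finset.insert_subset_iff, hp, hq, hVP hrV])
    omega
  obtain ⟨-, v2, -, v4, -⟩ := HardCase.val_neg (n := n) hn
  have hUP : (eraseP n P).erase (s(-5, -3)) ⊆ P := (Finset.erase_subset _ _).trans hVP
  have hval : ∀ x y : ZMod n, x = y ↔ x.val = y.val := fun x y =>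
    (ZMod.val_injective n).eq_iff.symm
  have hempty := greedyRun_eq_empty hadm.dense hadm.noncross (show 3 ≤ n by omega)
  refine ⟨(eraseP n P).erase (s(-5, -3)), r, ⟨hn, ?_, ?_, hpV, Finset.notMem_erase _ _, ?_, ?_, ?_,
    Finset.mem_erase.2 ⟨hrq, hrV⟩, ⟨hr1, ?_⟩, hempty, fun i => ?_, ?_, ?_⟩⟩
  · exact (Finset.insert_erase hp).symm
  · exact (Finset.insert_erase hqV).symm
  · intro x
    have hx := x.val_lt
    simp only [mem_supp, Sym2.mem_iff, exists_eq_or_imp, exists_eq_left,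
      show (-3 : ZMod n) + 1 = -2 by norm_num, show (-1 : ZMod n) + 1 = 0 by norm_num, hval x,
      v1, v2, v3, ZMod.val_zero]
    omega
  · intro x
    have hx := x.val_lt
    simp only [mem_supp, Sym2.mem_iff, exists_eq_or_imp, exists_eq_left,
      show (-3 : ZMod n) + 1 = -2 by norm_num, show (-5 : ZMod n) + 1 = -4 by norm_num, hval x,
      v2, v3, v4, v5]
    omega
  · intro u hu
    have hup : u ≠ s(-3, -1) := fun h => hpV (h ▸ Finset.mem_of_mem_erase hu)
    have hu3 : (-3 : ZMod n) ∉ u := fun h =>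
      (hon3 u (hUP hu) h).elim hup (Finset.ne_of_mem_erase hu)
    refine ⟨fun h => ?_, fun h => hu3 (hsupp2 u (hUP hu) h)⟩
    obtain ⟨e, he, h | h⟩ := mem_supp.1 h
    · exact hu3 (h ▸ he)
    · exact hmid4 u (hUP hu) (by rwa [show (-4 : ZMod n) = e by linear_combination h])
  · exact mem_supp.2 ⟨-1, hr1', Or.inr (by norm_num)⟩
  · exact Finset.subset_empty.1 (hempty i ▸ greedyRun_mono hVP i (n - 3))
  · rw [greedyStep_eq_erase hq]
    · ext u
      simp only [eraseP, Finset.mem_erase, Finset.mem_insert]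
      constructor
      · intro h
        tauto
      · rintro (rfl | h)
        exacts [⟨hpq, hp⟩, ⟨h.1, h.2.2⟩]
    · exact mem_supp.2 ⟨-3, Sym2.mem_mk_right _ _, Or.inr (by norm_num)⟩
    · intro u hu hu2
      rcases hon3 u hu (hsupp2 u hu hu2) with rfl | rfl
      swap
      · exact le_rfl
      rw [cwKey, cwKey, show (-2 : ZMod n) - 1 = -3 by norm_num, if_pos (Sym2.mem_mk_left _ _),
        if_pos (Sym2.mem_mk_right _ _), otherEnd_mk, Sym2.eq_swap, otherEnd_mk,
        HardCase.ord_val_eq v3, HardCase.ord_val_eq v3, v1, v5]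
      split_ifs <;> omega
  · have hpU : (s(-3, -1) : Prp n) ∉ (eraseP n P).erase (s(-5, -3)) := fun h =>
      hpV (Finset.mem_of_mem_erase h)
    rw [greedyStep_eq_erase (Finset.mem_insert_self _ _), Finset.erase_insert hpU]
    · exact mem_supp.2 ⟨-1, Sym2.mem_mk_right _ _, Or.inl rfl⟩
    · intro u hu hu1
      have huP : u ∈ P := by
        rcases Finset.mem_insert.1 hu with rfl | hu
        exacts [hp, hUP hu]
      have hkey : ∀ s ∈ P, cwKey n (-1) s = ord n (-1) (otherEnd n s (-1)) := by
        intro s hs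
        rw [cwKey, show (-1 : ZMod n) - 1 = -2 by norm_num, if_neg (hmid2 s hs)]
      have hu := otherEnd_spec (hsupp1 u huP hu1)
      have hle := (two_le_ord_of_dense hadm.dense (hu ▸ huP)).2
      rw [hkey u huP, hkey _ hp, show (s(-3, -1) : Prp n) = s(-1, -3) from Sym2.eq_swap,
        otherEnd_mk, HardCase.ord_val_eq v1 (x := -3), v3]
      split_ifs <;> omega

end Construction

/-- plusses from the term `I_{n-2}^W`, hard case.
Under the Setup, suppose both `n-2` and `n-1` lie in `I_{n-2}^V`, and let `c` be
the largest element of `I_1^V` in the `<₁` order.  Then: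
(1) `c = n-4` if `n-4 ∈ I_1^V \ I_n^V`, and `c = n-5` otherwise; moreover if
`c = n-4` then `I_1^V \ I_n^V = {n-4}`;
(2) `I_{n-3}^W` contributes the same plusses as `I_{n-3}^V` except that the
plus in column `n-3` (which necessarily exists) is shifted one square left into
column `n-2`;
(3) `I_{n-2}^V` contributes a `c → (n-2)` plus, no other term of the Grassmann
necklace of `V` gives a plus in column `n-2`, and all other plusses of
`I_{n-2}^V` were already contributed by `I_{n-3}^V`;
(4) `I_{n-2}^W` contributes an `(n-3) → (n-2)` plus, a `c → (n-1)` plus, and one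
further plus, which is the plus contributed by `I_n^V` if `c = n-5` and is the
`(n-5) → n` plus if `c = n-4`;
(5) if `c = n-4` then `I_{n-1}^V` contributes an `(n-4) → (n-1)` plus; in any
case all other plusses contributed by `I_{n-1}^V` were already contributed by
`I_{n-3}^V`;
(6) the Grassmann necklace of `V` contributes a `c → (n-1)` plus if and only if
`c = n-4`, and no term of the Grassmann necklace of `V` contributes an
`(n-5) → n` plus. -/
theorem lePlus_of_term_n_sub_two_hard_case
    (n : ℕ) [NeZero n] (P : Finset (Prp n))
    (hadm : IsAdmissible n P) (hne : P.Nonempty)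
    (hp : (s(-3, -1) : Prp n) ∈ P)
    (hlen : plength n (s(-3, -1) : Prp n) = 2)
    (hin : ∀ r ∈ P, InsideDir n (-3) (s(-3, -1) : Prp n) r → r = (s(-3, -1) : Prp n))
    (hedge : (∀ r ∈ P, (-3 : ZMod n) ∈ r → r = (s(-3, -1) : Prp n)) ∨
      ((s(-5, -3) : Prp n) ∈ P ∧ plength n (s(-5, -3) : Prp n) = 2 ∧
        (∀ r ∈ P, (-3 : ZMod n) ∈ r →
          r = (s(-3, -1) : Prp n) ∨ r = (s(-5, -3) : Prp n)) ∧
        (∀ r ∈ P, InsideDir n (-5) (s(-5, -3) : Prp n) r → r = (s(-5, -3) : Prp n))))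
    (h2 : (-2 : ZMod n) ∈ gnSet n (eraseP n P) (-2))
    (h1 : (-1 : ZMod n) ∈ gnSet n (eraseP n P) (-2))
    (c : ZMod n) (hc : c ∈ gnSet n (eraseP n P) 1)
    (hcmax : ∀ x ∈ gnSet n (eraseP n P) 1, ord n 1 x ≤ ord n 1 c) :
    (((-4 : ZMod n) ∈ gnSet n (eraseP n P) 1 \ gnSet n (eraseP n P) 0 → c = -4) ∧
     ((-4 : ZMod n) ∉ gnSet n (eraseP n P) 1 \ gnSet n (eraseP n P) 0 → c = -5) ∧
     (c = -4 → gnSet n (eraseP n P) 1 \ gnSet n (eraseP n P) 0 = {(-4 : ZMod n)})) ∧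
    ((∃ a : ZMod n,
        LePlusAt n (gnSet n (eraseP n P) 1) (gnSet n (eraseP n P) (-3)) a (-3)) ∧
     (∀ a b : ZMod n,
        LePlusAt n (gnSet n P 1) (gnSet n P (-3)) a b ↔
          ((b ≠ -3 ∧
              LePlusAt n (gnSet n (eraseP n P) 1) (gnSet n (eraseP n P) (-3)) a b) ∨
           (b = -2 ∧
              LePlusAt n (gnSet n (eraseP n P) 1) (gnSet n (eraseP n P) (-3)) a (-3))))) ∧
    (LePlusAt n (gnSet n (eraseP n P) 1) (gnSet n (eraseP n P) (-2)) c (-2) ∧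
     (∀ m : ZMod n, m ≠ -2 → ∀ a : ZMod n,
        ¬ LePlusAt n (gnSet n (eraseP n P) 1) (gnSet n (eraseP n P) m) a (-2)) ∧
     (∀ a b : ZMod n,
        LePlusAt n (gnSet n (eraseP n P) 1) (gnSet n (eraseP n P) (-2)) a b → b ≠ -2 →
          LePlusAt n (gnSet n (eraseP n P) 1) (gnSet n (eraseP n P) (-3)) a b)) ∧
    (LePlusAt n (gnSet n P 1) (gnSet n P (-2)) (-3) (-2) ∧
     LePlusAt n (gnSet n P 1) (gnSet n P (-2)) c (-1) ∧
     (c = -5 → ∀ a b : ZMod n,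
        LePlusAt n (gnSet n P 1) (gnSet n P (-2)) a b ↔
          ((a = -3 ∧ b = -2) ∨ (a = c ∧ b = -1) ∨
            LePlusAt n (gnSet n (eraseP n P) 1) (gnSet n (eraseP n P) 0) a b)) ∧
     (c = -4 → ∀ a b : ZMod n,
        LePlusAt n (gnSet n P 1) (gnSet n P (-2)) a b ↔
          ((a = -3 ∧ b = -2) ∨ (a = -4 ∧ b = -1) ∨ (a = -5 ∧ b = 0)))) ∧
    ((c = -4 →
        LePlusAt n (gnSet n (eraseP n P) 1) (gnSet n (eraseP n P) (-1)) (-4) (-1)) ∧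
     (∀ a b : ZMod n,
        LePlusAt n (gnSet n (eraseP n P) 1) (gnSet n (eraseP n P) (-1)) a b →
          (a = -4 ∧ b = -1) ∨
            LePlusAt n (gnSet n (eraseP n P) 1) (gnSet n (eraseP n P) (-3)) a b)) ∧
    (((∃ m : ZMod n,
        LePlusAt n (gnSet n (eraseP n P) 1) (gnSet n (eraseP n P) m) c (-1)) ↔
          c = -4) ∧
     (∀ m : ZMod n,
        ¬ LePlusAt n (gnSet n (eraseP n P) 1) (gnSet n (eraseP n P) m) (-5) 0)) := by
  obtain ⟨U, r, H⟩ := exists_hardCase hadm hp (hedge.imp_right fun h => ⟨h.1, h.2.2.1⟩) h2 h1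
  refine ⟨H.max_row hc hcmax, ⟨⟨c, ?_⟩, H.lePlusAt_W_neg_three_iff hc hcmax⟩,
    ⟨?_, ?_, H.lePlusAt_V_neg_two_imp hc hcmax⟩,
    ⟨?_, ?_, H.lePlusAt_W_neg_two_of_eq_neg_five hc hcmax,
      H.lePlusAt_W_neg_two_of_eq_neg_four hc hcmax⟩,
    ⟨fun h => ?_, H.lePlusAt_V_neg_one_imp hc hcmax⟩,
    H.exists_lePlusAt_neg_one_iff hc hcmax, H.not_lePlusAt_neg_five_zero hc hcmax⟩
  · exact (H.lePlusAt_V_neg_three hc hcmax _ _).2 (Or.inl ⟨rfl, rfl⟩)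
  · exact (H.lePlusAt_V_neg_two hc hcmax _ _).2 (Or.inl ⟨rfl, rfl⟩)
  · exact fun m hm a h => H.neg_two_notMem hm (Finset.mem_sdiff.1 h.2.1).1
  · rcases H.max_eq hc hcmax with h | h
    · exact (H.lePlusAt_W_neg_two_of_eq_neg_four hc hcmax h _ _).2 (Or.inl ⟨rfl, rfl⟩)
    · exact (H.lePlusAt_W_neg_two_of_eq_neg_five hc hcmax h _ _).2 (Or.inl ⟨rfl, rfl⟩)
  · rcases H.max_eq hc hcmax with h | h
    · exact (H.lePlusAt_W_neg_two_of_eq_neg_four hc hcmax h _ _).2 (Or.inr (Or.inl ⟨h, rfl⟩))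
    · exact (H.lePlusAt_W_neg_two_of_eq_neg_five hc hcmax h _ _).2 (Or.inr (Or.inl ⟨rfl, rfl⟩))
  · obtain ⟨A, B, -, -, -, hV⟩ := H.lePlusAt_of_eq_neg_four hc hcmax h
    exact (hV _ _).2 (Or.inl ⟨rfl, rfl⟩)

end WLD
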